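/- For every T ∈ (0, ∞) there exists a constant C_T > 0 such that for every real M ≥ 1 and all Schwartz-regular solutions u, v of the linear equation i ∂ₜw − Δw + |x|² w = 0 one has ∫₀^T ∫∫_{ {(x,y) ∈ ℝ²×ℝ² : |x₁−y₁| < 1/M} } M · | conj(v(t,y)) ∂_{x₁} u(t,x) + u(t,x) ∂_{y₁} conj(v(t,y)) |² dx dy dt ≤ C_T ( ‖v(0)‖²_{L²} ‖u(0)‖_{L²} ‖u(0)‖_{ℋ¹} + ‖u(0)‖²_{L²} ‖v(0)‖_{L²} ‖v(0)‖_{ℋ¹} ). -/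

import Mathlib

open MeasureTheory Complex

noncomputable section

abbrev E2 : Type := EuclideanSpace ℝ (Fin 2)

/-- Partial derivative in the `i`-th coordinate direction. -/
noncomputable def pd (i : Fin 2) (f : E2 → ℂ) : E2 → ℂ :=
  fun x => fderiv ℝ f x (EuclideanSpace.single i 1)

/-- The Laplacian on `ℝ²`. -/
noncomputable def lap (f : E2 → ℂ) : E2 → ℂ :=
  fun x => ∑ i : Fin 2, pd i (pd i f) x

/-- The harmonic oscillator `A f = -Δ f + |x|² f`. -/
noncomputable def Aop (f : E2 → ℂ) : E2 → ℂ :=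
  fun x => -lap f x + (‖x‖ : ℂ)^2 * f x

/-- Time derivative of a time-dependent function. -/
noncomputable def tderiv (F : ℝ → E2 → ℂ) : ℝ → E2 → ℂ :=
  fun t x => deriv (fun s => F s x) t

/-- Squared euclidean norm of the gradient, `|∇f|²(x)`. -/
noncomputable def gradSq (f : E2 → ℂ) (x : E2) : ℝ := ∑ i : Fin 2, ‖pd i f x‖^2

/-- The `L²` norm. -/
noncomputable def L2norm (f : E2 → ℂ) : ℝ := Real.sqrt (∫ x : E2, ‖f x‖^2)

/-- The `ℋ¹` norm: `(‖∇φ‖² + ‖|x|φ‖²)^(1/2)`. -/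
noncomputable def H1norm (f : E2 → ℂ) : ℝ :=
  Real.sqrt ((∫ x : E2, gradSq f x) + ∫ x : E2, ‖x‖^2 * ‖f x‖^2)

/-- A Schwartz-regular solution of the cubic NLS with harmonic potential,
`i ∂ₜ u - Δu + |x|² u + σ u |u|² = 0`. -/
def IsSolution (σ : ℝ) (u : ℝ → SchwartzMap E2 ℂ) : Prop :=
  ContDiff ℝ (⊤ : ℕ∞) (fun p : ℝ × E2 => u p.1 p.2) ∧
  ∀ (t : ℝ) (x : E2), Complex.I * deriv (fun s => u s x) t - lap (fun y => u t y) x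
    + (‖x‖ : ℂ)^2 * u t x + (σ : ℂ) * u t x * (‖u t x‖ : ℂ)^2 = 0

/-- A Schwartz-regular solution of the linear Schrödinger equation with harmonic
potential, `i ∂ₜ w - Δw + |x|² w = 0`. -/
def IsLinSolution (w : ℝ → SchwartzMap E2 ℂ) : Prop :=
  ContDiff ℝ (⊤ : ℕ∞) (fun p : ℝ × E2 => w p.1 p.2) ∧
  ∀ (t : ℝ) (x : E2), Complex.I * deriv (fun s => w s x) t - lap (fun y => w t y) x
    + (‖x‖ : ℂ)^2 * w t x = 0

/-- Partial derivative for real-valued functions. -/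
noncomputable def pdR (i : Fin 2) (f : E2 → ℝ) : E2 → ℝ :=
  fun x => fderiv ℝ f x (EuclideanSpace.single i 1)

/-- The Laplacian for real-valued functions. -/
noncomputable def lapR (f : E2 → ℝ) : E2 → ℝ :=
  fun x => ∑ i : Fin 2, pdR i (pdR i f) x

/-- A finite real function with closed sublevel sets that is constant on every compact interval on
which it is bounded above is constant. -/
theorem eq_of_isClosed_sublevel_of_const_of_bounded {P : ℝ → ℝ}
    (hcl : ∀ K : ℝ, IsClosed {t | P t ≤ K})
    (hconst : ∀ a b K : ℝ, (∀ t ∈ Set.Icc a b, P t ≤ K) →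
      ∀ s ∈ Set.Icc a b, ∀ t ∈ Set.Icc a b, P s = P t) (s t : ℝ) : P s = P t := by
  set U : Set ℝ := {x | ∀ᶠ y in nhds x, P y = P x} with hU
  have hUmem : ∀ x δ K : ℝ, 0 < δ → (∀ y, |y - x| < δ → P y ≤ K) → x ∈ U := by
    intro x δ K hδ h
    have h2 := hconst (x - δ/2) (x + δ/2) K (fun y hy => h y (by
      rw [abs_lt]; constructor <;> linarith [hy.1, hy.2]))
    have : Set.Icc (x - δ/2) (x + δ/2) ∈ nhds x := Icc_mem_nhds (by linarith) (by linarith)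
    filter_upwards [this] with y hy
    exact h2 y hy x ⟨by linarith, by linarith⟩
  have hUo : IsOpen U := by
    rw [isOpen_iff_mem_nhds]
    intro x hx
    have hx' : ∀ᶠ y in nhds x, P y = P x := hx
    filter_upwards [hx'.eventually_nhds, hx'] with y hy hyx
    filter_upwards [hy] with z hz
    rw [hz, hyx]
  have hconn : ∀ S : Set ℝ, IsPreconnected S → S ⊆ U → ∀ x ∈ S, ∀ y ∈ S, P x = P y := by
    intro S hS hSU x hx y hy
    have hA : IsOpen {z | ∀ᶠ w in nhds z, P w = P x} :=
      isOpen_iff_mem_nhds.2 fun z hz => eventually_eventually_nhds.2 hz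
    have hB : IsOpen {z | ∀ᶠ w in nhds z, P w ≠ P x} :=
      isOpen_iff_mem_nhds.2 fun z hz => eventually_eventually_nhds.2 hz
    have hsub : S ⊆ {z | ∀ᶠ w in nhds z, P w = P x} := by
      refine hS.subset_left_of_subset_union hA hB ?_ ?_ ⟨x, hx, hSU hx⟩
      · exact Set.disjoint_left.2 fun z hz hz' => hz'.self_of_nhds hz.self_of_nhds
      · intro z hz
        have hzU : ∀ᶠ w in nhds z, P w = P z := hSU hz
        by_cases h : P z = P x
        · exact Or.inl (hzU.mono fun w hw => hw.trans h)
        · exact Or.inr (hzU.mono fun w hw => hw ▸ h)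
    exact ((hsub hy).self_of_nhds).symm
  have hUuniv : U = Set.univ := by
    by_contra hne
    have hFne : (Uᶜ).Nonempty := Set.nonempty_compl.2 hne
    have hFc : IsClosed Uᶜ := hUo.isClosed_compl
    have : Nonempty (Uᶜ : Set ℝ) := hFne.to_subtype
    have : CompleteSpace (Uᶜ : Set ℝ) := hFc.completeSpace_coe
    obtain ⟨n, x, hx⟩ := nonempty_interior_of_iUnion_of_closed
      (f := fun n : ℕ => {y : (Uᶜ : Set ℝ) | P y ≤ n})
      (fun n => (hcl n).preimage continuous_subtype_val)
      (by
        ext y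
        simp only [Set.mem_iUnion, Set.mem_ofPred_eq, Set.mem_univ, iff_true]
        exact exists_nat_ge _)
    rw [mem_interior_iff_mem_nhds, Metric.mem_nhds_iff] at hx
    obtain ⟨δ, hδ, hball⟩ := hx
    have hF : ∀ y ∈ Uᶜ, |y - x| < δ → P y ≤ n := fun y hy hyx =>
      hball (show (⟨y, hy⟩ : (Uᶜ : Set ℝ)) ∈ Metric.ball x δ by
        rw [Metric.mem_ball, Subtype.dist_eq, Real.dist_eq]; exact hyx)
    refine x.2 (hUmem x δ n hδ fun y hy => ?_)
    by_cases hyU : y ∈ U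
    swap
    · exact hF y hyU hy
    rcases le_total (x : ℝ) y with hxy | hxy
    · obtain ⟨c, ⟨hcF, hcx, hcy⟩, hcmax⟩ : ∃ c, c ∈ (Uᶜ ∩ Set.Icc (x : ℝ) y) ∧
          ∀ z ∈ Uᶜ ∩ Set.Icc (x : ℝ) y, z ≤ c :=
        (isCompact_Icc.inter_left hFc).exists_isMaxOn ⟨x, x.2, le_rfl, hxy⟩ continuousOn_id
      have hcy' : c < y := lt_of_le_of_ne hcy (fun h => hcF (h ▸ hyU))
      have hsub : Set.Ioc c y ⊆ U := by
        intro z hz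
        by_contra hzU
        exact absurd (hcmax z ⟨hzU, hcx.trans hz.1.le, hz.2⟩) (not_le.2 hz.1)
      have hall : ∀ z ∈ Set.Ioc c y, P z ≤ P y := fun z hz =>
        (hconn _ isPreconnected_Ioc hsub z hz y ⟨hcy', le_rfl⟩).le
      have hcl' : Set.Icc c y ⊆ {z | P z ≤ P y} := by
        rw [← closure_Ioc hcy'.ne]
        exact closure_minimal hall (hcl _)
      rw [hconst c y _ hcl' y ⟨hcy, le_rfl⟩ c ⟨le_rfl, hcy⟩]
      exact hF c hcF (by rw [abs_lt] at hy ⊢; constructor <;> linarith)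
    · obtain ⟨c, ⟨hcF, hcy, hcx⟩, hcmin⟩ : ∃ c, c ∈ (Uᶜ ∩ Set.Icc y (x : ℝ)) ∧
          ∀ z ∈ Uᶜ ∩ Set.Icc y (x : ℝ), c ≤ z :=
        (isCompact_Icc.inter_left hFc).exists_isMinOn ⟨x, x.2, hxy, le_rfl⟩ continuousOn_id
      have hcy' : y < c := lt_of_le_of_ne hcy (fun h => hcF (h ▸ hyU))
      have hsub : Set.Ico y c ⊆ U := by
        intro z hz
        by_contra hzU
        exact absurd (hcmin z ⟨hzU, hz.1, hz.2.le.trans hcx⟩) (not_le.2 hz.2)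
      have hall : ∀ z ∈ Set.Ico y c, P z ≤ P y := fun z hz =>
        (hconn _ isPreconnected_Ico hsub z hz y ⟨le_rfl, hcy'⟩).le
      have hcl' : Set.Icc y c ⊆ {z | P z ≤ P y} := by
        rw [← closure_Ico hcy'.ne]
        exact closure_minimal hall (hcl _)
      rw [hconst y c _ hcl' y ⟨le_rfl, hcy⟩ c ⟨hcy, le_rfl⟩]
      exact hF c hcF (by rw [abs_lt] at hy ⊢; constructor <;> linarith)
  exact hconn Set.univ isPreconnected_univ hUuniv.ge s trivial t trivial

section Rapid
variable {V : Type*} [NormedAddCommGroup V] [NormedSpace ℝ V]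

/-- The function `f` is (the underlying function of) a Schwartz function. -/
def IsSchwartz (f : V → ℂ) : Prop := ∃ g : SchwartzMap V ℂ, ∀ x, g x = f x

theorem SchwartzMap.isSchwartz (f : SchwartzMap V ℂ) : IsSchwartz (fun x => f x) := ⟨f, fun _ => rfl⟩

namespace IsSchwartz
variable {f g : V → ℂ}

theorem congr (hf : IsSchwartz f) (h : ∀ x, f x = g x) : IsSchwartz g :=
  let ⟨F, hF⟩ := hf
  ⟨F, fun x => (hF x).trans (h x)⟩

theorem add (hf : IsSchwartz f) (hg : IsSchwartz g) : IsSchwartz (fun x => f x + g x) :=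
  let ⟨F, hF⟩ := hf
  let ⟨G, hG⟩ := hg
  ⟨F + G, fun x => by simp [hF, hG]⟩

theorem neg (hf : IsSchwartz f) : IsSchwartz (fun x => - f x) :=
  let ⟨F, hF⟩ := hf
  ⟨-F, fun x => by simp [hF]⟩

theorem sub (hf : IsSchwartz f) (hg : IsSchwartz g) : IsSchwartz (fun x => f x - g x) :=
  let ⟨F, hF⟩ := hf
  let ⟨G, hG⟩ := hg
  ⟨F - G, fun x => by simp [hF, hG]⟩

theorem tmul (hf : IsSchwartz f) {p : V → ℂ} (hp : p.HasTemperateGrowth) :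
    IsSchwartz (fun x => p x * f x) :=
  let ⟨F, hF⟩ := hf
  ⟨SchwartzMap.smulLeftCLM ℂ p F, fun x => by
    rw [SchwartzMap.smulLeftCLM_apply_apply hp, hF, smul_eq_mul]⟩

theorem hasTemperateGrowth (hf : IsSchwartz f) : f.HasTemperateGrowth :=
  let ⟨F, hF⟩ := hf
  (funext hF : (F : V → ℂ) = f) ▸ F.hasTemperateGrowth

theorem mul (hf : IsSchwartz f) (hg : IsSchwartz g) : IsSchwartz (fun x => f x * g x) :=
  hg.tmul hf.hasTemperateGrowth

theorem const_mul (c : ℂ) (hf : IsSchwartz f) : IsSchwartz (fun x => c * f x) :=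
  hf.tmul (Function.HasTemperateGrowth.const c)

theorem conj (hf : IsSchwartz f) : IsSchwartz (fun x => (starRingEnd ℂ) (f x)) :=
  let ⟨F, hF⟩ := hf
  ⟨SchwartzMap.postcompCLM (𝕜 := ℝ) (Complex.conjCLE : ℂ →L[ℝ] ℂ) F, fun x => by
    rw [SchwartzMap.postcompCLM_apply, hF]; rfl⟩

theorem contDiff (hf : IsSchwartz f) : ContDiff ℝ (⊤ : ℕ∞) f :=
  let ⟨F, hF⟩ := hf
  (funext hF : (F : V → ℂ) = f) ▸ F.smooth ⊤

theorem differentiable (hf : IsSchwartz f) : Differentiable ℝ f :=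
  hf.contDiff.differentiable (by simp)

theorem continuous (hf : IsSchwartz f) : Continuous f := hf.contDiff.continuous

theorem fderiv_apply (hf : IsSchwartz f) (v : V) : IsSchwartz (fun x => fderiv ℝ f x v) := by
  obtain ⟨F, hF⟩ := hf
  refine ⟨LineDeriv.lineDerivOp v F, fun x => ?_⟩
  rw [SchwartzMap.lineDerivOp_apply_eq_fderiv, (funext hF : (F : V → ℂ) = f)]

theorem integrable [MeasurableSpace V] [BorelSpace V] [SecondCountableTopology V] {μ : Measure V}
    [μ.HasTemperateGrowth] (hf : IsSchwartz f) : Integrable f μ := by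
  obtain ⟨F, hF⟩ := hf
  rw [← (funext hF : (F : V → ℂ) = f)]
  exact F.integrable

theorem integrable_normSq [MeasurableSpace V] [BorelSpace V] [SecondCountableTopology V]
    {μ : Measure V} [μ.HasTemperateGrowth] (hf : IsSchwartz f) :
    Integrable (fun x => ‖f x‖ ^ 2) μ := by
  have := (hf.conj.mul hf).integrable (μ := μ) |>.re
  refine this.congr (Filter.Eventually.of_forall fun x => ?_)
  simp only [RCLike.re_eq_complex_re]
  rw [Complex.conj_mul']
  norm_cast

theorem bdd (hf : IsSchwartz f) : ∃ C, ∀ x, ‖f x‖ ≤ C := by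
  obtain ⟨F, hF⟩ := hf
  refine ⟨SchwartzMap.seminorm ℝ 0 0 F, fun x => ?_⟩
  rw [← hF]
  exact F.norm_le_seminorm ℝ x

end IsSchwartz

section Tensor
variable {W : Type*} [NormedAddCommGroup W] [NormedSpace ℝ W]

theorem IsSchwartz.prod_mul {f : V → ℂ} {g : W → ℂ} (hf : IsSchwartz f) (hg : IsSchwartz g) :
    IsSchwartz (fun q : V × W => f q.1 * g q.2) := by
  obtain ⟨F, hF⟩ := hf
  obtain ⟨G, hG⟩ := hg
  obtain rfl : (F : V → ℂ) = f := funext hF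
  obtain rfl : (G : W → ℂ) = g := funext hG
  have h1 : ContDiff ℝ (⊤ : ℕ∞) (fun q : V × W => F q.1) := (F.smooth ⊤).comp contDiff_fst
  have h2 : ContDiff ℝ (⊤ : ℕ∞) (fun q : V × W => G q.2) := (G.smooth ⊤).comp contDiff_snd
  have b1 : ∀ (n : ℕ) (q : V × W), ‖iteratedFDeriv ℝ n (fun q : V × W => F q.1) q‖ ≤
      ‖iteratedFDeriv ℝ n F q.1‖ := by
    intro n q
    have := (ContinuousLinearMap.fst ℝ V W).iteratedFDeriv_comp_right (F.smooth ⊤) q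
      (i := n) (by exact_mod_cast le_top)
    change ‖iteratedFDeriv ℝ n (F ∘ (ContinuousLinearMap.fst ℝ V W)) q‖ ≤ _
    rw [this]
    refine (ContinuousMultilinearMap.norm_compContinuousLinearMap_le _ _).trans ?_
    refine mul_le_of_le_one_right (norm_nonneg _) (Finset.prod_le_one (fun _ _ => norm_nonneg _)
      fun _ _ => ContinuousLinearMap.norm_fst_le ℝ V W)
  have b2 : ∀ (n : ℕ) (q : V × W), ‖iteratedFDeriv ℝ n (fun q : V × W => G q.2) q‖ ≤
      ‖iteratedFDeriv ℝ n G q.2‖ := by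
    intro n q
    have := (ContinuousLinearMap.snd ℝ V W).iteratedFDeriv_comp_right (G.smooth ⊤) q
      (i := n) (by exact_mod_cast le_top)
    change ‖iteratedFDeriv ℝ n (G ∘ (ContinuousLinearMap.snd ℝ V W)) q‖ ≤ _
    rw [this]
    refine (ContinuousMultilinearMap.norm_compContinuousLinearMap_le _ _).trans ?_
    refine mul_le_of_le_one_right (norm_nonneg _) (Finset.prod_le_one (fun _ _ => norm_nonneg _)
      fun _ _ => ContinuousLinearMap.norm_snd_le ℝ V W)
  refine ⟨⟨fun q => F q.1 * G q.2, h1.mul h2, fun k n => ?_⟩, fun _ => rfl⟩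
  choose A hA using fun i => F.decay k i
  choose A' hA' using fun i => F.decay 0 i
  choose B hB using fun i => G.decay k i
  choose B' hB' using fun i => G.decay 0 i
  refine ⟨∑ i ∈ Finset.range (n + 1), (n.choose i : ℝ) * (A i * B' (n - i) + A' i * B (n - i)),
    fun q => ?_⟩
  have hle := norm_iteratedFDeriv_mul_le (n := n) h1 h2 q (by exact_mod_cast le_top)
  calc ‖q‖ ^ k * ‖iteratedFDeriv ℝ n (fun q : V × W => F q.1 * G q.2) q‖
      ≤ ‖q‖ ^ k * ∑ i ∈ Finset.range (n + 1), (n.choose i : ℝ) *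
        ‖iteratedFDeriv ℝ i (fun q : V × W => F q.1) q‖ *
        ‖iteratedFDeriv ℝ (n - i) (fun q : V × W => G q.2) q‖ := by gcongr
    _ ≤ _ := by
      rw [Finset.mul_sum]
      refine Finset.sum_le_sum fun i _ => ?_
      have hq : ‖q‖ ^ k ≤ ‖q.1‖ ^ k + ‖q.2‖ ^ k := by
        rw [Prod.norm_def]
        rcases max_choice ‖q.1‖ ‖q.2‖ with h | h <;> rw [h]
        · exact le_add_of_nonneg_right (by positivity)
        · exact le_add_of_nonneg_left (by positivity)
      have e1 := (hA i).2 q.1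
      have e2 := (hA' i).2 q.1
      have e3 := (hB (n - i)).2 q.2
      have e4 := (hB' (n - i)).2 q.2
      rw [pow_zero, one_mul] at e2 e4
      have p1 := b1 i q
      have p2 := b2 (n - i) q
      calc ‖q‖ ^ k * ((n.choose i : ℝ) * ‖iteratedFDeriv ℝ i (fun q : V × W => F q.1) q‖ *
            ‖iteratedFDeriv ℝ (n - i) (fun q : V × W => G q.2) q‖)
          ≤ (‖q.1‖ ^ k + ‖q.2‖ ^ k) * ((n.choose i : ℝ) * ‖iteratedFDeriv ℝ i F q.1‖ *
            ‖iteratedFDeriv ℝ (n - i) G q.2‖) := by gcongr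
        _ = (n.choose i : ℝ) * ((‖q.1‖ ^ k * ‖iteratedFDeriv ℝ i F q.1‖) *
            ‖iteratedFDeriv ℝ (n - i) G q.2‖ + ‖iteratedFDeriv ℝ i F q.1‖ *
            (‖q.2‖ ^ k * ‖iteratedFDeriv ℝ (n - i) G q.2‖)) := by ring
        _ ≤ _ := by
          have hA0 : 0 ≤ A i := le_trans (by positivity) e1
          have hA0' : 0 ≤ A' i := le_trans (by positivity) e2
          gcongr

end Tensor

section Parts
variable [FiniteDimensional ℝ V] [MeasurableSpace V] [BorelSpace V] {μ : Measure V}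
  [μ.IsAddHaarMeasure]

/-- Integration by parts against a bounded weight with bounded derivative. -/
theorem integral_weight_mul_fderiv {f g S : V → ℂ} (hf : IsSchwartz f) (hg : IsSchwartz g)
    (v : V) {S' : V → ℂ} (hSc : Continuous S) (hSc' : Continuous S')
    (hS : ∀ x, HasLineDerivAt ℝ S (S' x) x v) {C : ℝ}
    (hb : ∀ x, ‖S x‖ ≤ C) (hb' : ∀ x, ‖S' x‖ ≤ C) :
    ∫ x, S x * (fderiv ℝ f x v * g x) ∂μ =
      - (∫ x, S x * (f x * fderiv ℝ g x v) ∂μ) - ∫ x, S' x * (f x * g x) ∂μ := by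
  have bi : ∀ {T h : V → ℂ}, Continuous T → (∀ x, ‖T x‖ ≤ C) → IsSchwartz h →
      Integrable (fun x => T x * h x) μ := fun {T h} hT hTb hh =>
    hh.integrable.bdd_mul hT.aestronglyMeasurable (Filter.Eventually.of_forall hTb)
  have i1 := bi hSc hb ((hf.fderiv_apply v).mul hg)
  have i2 := bi hSc hb (hf.mul (hg.fderiv_apply v))
  have i3 := bi hSc' hb' (hf.mul hg)
  have hd : ∀ x, HasLineDerivAt ℝ (fun x => S x * (f x * g x))
      (S x * (fderiv ℝ f x v * g x) + S x * (f x * fderiv ℝ g x v) + S' x * (f x * g x)) x v := by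
    intro x
    have h1 := (hf.differentiable x).hasFDerivAt.hasLineDerivAt v
    have h2 := (hg.differentiable x).hasFDerivAt.hasLineDerivAt v
    have h3 := HasDerivAt.mul (hS x) (HasDerivAt.mul h1 h2)
    refine HasDerivAt.congr_deriv h3 ?_
    simp only [zero_smul, add_zero, Pi.mul_apply]
    ring
  have i12 : Integrable (fun x => S x * (fderiv ℝ f x v * g x) + S x * (f x * fderiv ℝ g x v)) μ :=
    i1.add i2
  have i123 : Integrable (fun x => S x * (fderiv ℝ f x v * g x) + S x * (f x * fderiv ℝ g x v)
      + S' x * (f x * g x)) μ := i12.add i3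
  have key := integral_bilinear_hasLineDerivAt_right_eq_neg_left_of_integrable (μ := μ)
    (f := fun _ : V => (1 : ℂ)) (f' := fun _ => 0)
    (g := fun x => S x * (f x * g x)) (v := v) (B := ContinuousLinearMap.mul ℝ ℂ)
    (g' := fun x => S x * (fderiv ℝ f x v * g x) + S x * (f x * fderiv ℝ g x v)
      + S' x * (f x * g x)) (by simp) (by simpa using i123)
    (by simpa using bi hSc hb (hf.mul hg))
    (fun x _ => hasDerivAt_const (0 : ℝ) (1 : ℂ)) (fun x _ => hd x)
  simp only [ContinuousLinearMap.mul_apply', one_mul, zero_mul, integral_zero, neg_zero] at key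
  rw [integral_add i12 i3, integral_add i1 i2] at key
  linear_combination key

theorem integral_fderiv_mul {f g : V → ℂ} (hf : IsSchwartz f) (hg : IsSchwartz g) (v : V) :
    ∫ x, fderiv ℝ f x v * g x ∂μ = - ∫ x, f x * fderiv ℝ g x v ∂μ := by
  have := integral_weight_mul_fderiv (μ := μ) (S := fun _ => 1) (S' := fun _ => 0) hf hg v
    continuous_const continuous_const (fun x => hasDerivAt_const (0 : ℝ) (1 : ℂ)) (C := 1)
    (by simp) (by simp)
  simpa using this

end Parts
end Rapid

section Temperate

theorem hasTemperateGrowth_cexp_mul_I :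
    (fun r : ℝ => cexp (r * I)).HasTemperateGrowth := by
  have hs : ContDiff ℝ (⊤ : ℕ∞) (fun r : ℝ => cexp (r * I)) :=
    (Complex.ofRealCLM.contDiff.mul contDiff_const).cexp
  have hd : ∀ n : ℕ, iteratedDeriv n (fun r : ℝ => cexp (r * I)) =
      fun r : ℝ => I ^ n * cexp (r * I) := by
    intro n
    induction n with
    | zero => simp
    | succ n ih =>
      rw [iteratedDeriv_succ, ih]
      funext r
      have h := ((((hasDerivAt_id (r : ℂ)).mul_const I).cexp).const_mul (I ^ n)).comp_ofReal
      simp only [id] at h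
      rw [h.deriv]
      ring
  refine ⟨hs, fun n => ⟨0, 1, fun x => ?_⟩⟩
  rw [norm_iteratedFDeriv_eq_norm_iteratedDeriv, hd]
  simp [norm_exp]

variable {V : Type*} [NormedAddCommGroup V] [NormedSpace ℝ V]

theorem hasTemperateGrowth_exp_of_nonpos {f : V → ℝ} (hf : f.HasTemperateGrowth)
    (h : ∀ x, f x ≤ 0) : (fun x => Real.exp (f x)).HasTemperateGrowth := by
  refine Function.HasTemperateGrowth.comp' (g := Real.exp) (t := Set.Iic 0) ?_
    (uniqueDiffOn_Iic 0) Real.contDiff_exp.contDiffOn (fun N => ⟨0, 1, zero_le_one, ?_⟩) hf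
  · rintro _ ⟨x, rfl⟩
    exact h x
  · intro n _ x hx
    rw [norm_iteratedFDerivWithin_eq_norm_iteratedDerivWithin,
      iteratedDerivWithin_eq_iteratedDeriv (uniqueDiffOn_Iic 0)
        Real.contDiff_exp.contDiffAt hx, iteratedDeriv_eq_iterate, Real.iter_deriv_exp]
    simpa using hx

end Temperate

section Pd
variable {f g : E2 → ℂ}

theorem pd_eq_of_hasLineDerivAt {i : Fin 2} {x : E2} {f' : ℂ} (hf : DifferentiableAt ℝ f x)
    (h : HasLineDerivAt ℝ f f' x (EuclideanSpace.single i 1)) : pd i f x = f' := by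
  rw [pd, ← hf.lineDeriv_eq_fderiv, h.lineDeriv]

theorem pd_mul {i : Fin 2} (hf : Differentiable ℝ f) (hg : Differentiable ℝ g) :
    pd i (fun x => f x * g x) = fun x => pd i f x * g x + f x * pd i g x := by
  funext x
  simp only [pd]
  rw [fderiv_fun_mul (hf x) (hg x)]
  simp
  ring

theorem pd_add {i : Fin 2} (hf : Differentiable ℝ f) (hg : Differentiable ℝ g) :
    pd i (fun x => f x + g x) = fun x => pd i f x + pd i g x := by
  funext x
  simp only [pd]
  rw [fderiv_fun_add (hf x) (hg x)]
  simp

theorem IsSchwartz.pd (hf : IsSchwartz f) (i : Fin 2) : IsSchwartz (pd i f) := hf.fderiv_apply _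

theorem IsSchwartz.lap (hf : IsSchwartz f) : IsSchwartz (lap f) := by
  refine (((hf.pd 0).pd 0).add ((hf.pd 1).pd 1)).congr fun x => ?_
  simp [_root_.lap, Fin.sum_univ_two]

theorem hasTemperateGrowth_coord (i : Fin 2) : (fun x : E2 => ((x i : ℝ) : ℂ)).HasTemperateGrowth :=
  (Complex.ofRealCLM.comp (EuclideanSpace.proj i : E2 →L[ℝ] ℝ)).hasTemperateGrowth

theorem norm_sq_E2 (x : E2) : ‖x‖ ^ 2 = x 0 ^ 2 + x 1 ^ 2 := by
  rw [EuclideanSpace.norm_sq_eq]; simp [Fin.sum_univ_two]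

theorem IsSchwartz.norm_sq_mul (hf : IsSchwartz f) :
    IsSchwartz (fun x => (‖x‖ : ℂ) ^ 2 * f x) := by
  refine (((hf.tmul (hasTemperateGrowth_coord 0)).tmul (hasTemperateGrowth_coord 0)).add
    ((hf.tmul (hasTemperateGrowth_coord 1)).tmul (hasTemperateGrowth_coord 1))).congr fun x => ?_
  rw [← ofReal_pow, norm_sq_E2]
  push_cast
  ring

theorem IsSchwartz.Aop (hf : IsSchwartz f) : IsSchwartz (Aop f) :=
  hf.lap.neg.add hf.norm_sq_mul

theorem integral_pd_mul (hf : IsSchwartz f) (hg : IsSchwartz g) (i : Fin 2) :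
    ∫ x, pd i f x * g x = - ∫ x, f x * pd i g x := integral_fderiv_mul hf hg _

theorem integral_Aop_mul (hf : IsSchwartz f) (hg : IsSchwartz g) :
    ∫ x, Aop f x * g x = ∫ x, f x * Aop g x := by
  have h : ∀ i, ∫ x, pd i (pd i f) x * g x = ∫ x, f x * pd i (pd i g) x := by
    intro i
    rw [integral_pd_mul (hf.pd i) hg, integral_pd_mul hf (hg.pd i), neg_neg]
  have e1 : ∀ x, Aop f x * g x = -(pd 0 (pd 0 f) x * g x) - pd 1 (pd 1 f) x * g x
      + ((‖x‖ : ℂ) ^ 2 * f x) * g x := by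
    intro x; simp [Aop, lap, Fin.sum_univ_two]; ring
  have e2 : ∀ x, f x * Aop g x = -(f x * pd 0 (pd 0 g) x) - f x * pd 1 (pd 1 g) x
      + ((‖x‖ : ℂ) ^ 2 * f x) * g x := by
    intro x; simp [Aop, lap, Fin.sum_univ_two]; ring
  simp_rw [e1, e2]
  have i0 := ((hf.pd 0).pd 0).mul hg
  have i1 := ((hf.pd 1).pd 1).mul hg
  have j0 := hf.mul ((hg.pd 0).pd 0)
  have j1 := hf.mul ((hg.pd 1).pd 1)
  have k := (hf.norm_sq_mul.mul hg).integrable (μ := volume)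
  rw [integral_add (i0.neg.sub i1).integrable k, integral_sub i0.neg.integrable i1.integrable,
    integral_neg, integral_add (j0.neg.sub j1).integrable k,
    integral_sub j0.neg.integrable j1.integrable, integral_neg, h, h]

end Pd

/-- A Gaussian wave packet centred at `Q` with momentum `P`. -/
def packet (Q P : E2) (θ : ℝ) (x : E2) : ℂ :=
  cexp (((-((x 0 - Q 0) ^ 2 + (x 1 - Q 1) ^ 2) / 2 : ℝ) : ℂ)
    + ((P 0 * x 0 + P 1 * x 1 + θ : ℝ) : ℂ) * I)

theorem norm_packet (Q P : E2) (θ : ℝ) (x : E2) :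
    ‖packet Q P θ x‖ = Real.exp (-‖x - Q‖ ^ 2 / 2) := by
  rw [packet, norm_exp, norm_sq_E2, Complex.add_re, Complex.ofReal_re, Complex.re_ofReal_mul,
    Complex.I_re, mul_zero, add_zero]
  simp only [PiLp.sub_apply]

theorem packet_hasTemperateGrowth (Q P : E2) (θ : ℝ) : (packet Q P θ).HasTemperateGrowth := by
  have hc : ∀ i, (fun x : E2 => x i).HasTemperateGrowth := fun i =>
    (EuclideanSpace.proj i : E2 →L[ℝ] ℝ).hasTemperateGrowth
  have h1 : (fun x : E2 => -((x 0 - Q 0) ^ 2 + (x 1 - Q 1) ^ 2) / 2).HasTemperateGrowth := by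
    have := hc 0
    have := hc 1
    have h2 : (fun x : E2 => (-1/2 : ℝ) * ((x 0 - Q 0) ^ 2 + (x 1 - Q 1) ^ 2)).HasTemperateGrowth :=
      (Function.HasTemperateGrowth.const _).mul
        ((((hc 0).sub (.const _)).pow 2).add (((hc 1).sub (.const _)).pow 2))
    convert h2 using 2
    ring
  have h2 : (fun x : E2 => P 0 * x 0 + P 1 * x 1 + θ).HasTemperateGrowth :=
    (((Function.HasTemperateGrowth.const _).mul (hc 0)).add
      ((Function.HasTemperateGrowth.const _).mul (hc 1))).add (.const _)
  have h3 := hasTemperateGrowth_exp_of_nonpos h1 (fun x => by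
    have := sq_nonneg (x 0 - Q 0)
    have := sq_nonneg (x 1 - Q 1)
    linarith)
  have h4 := (Complex.ofRealCLM.hasTemperateGrowth.comp h3).mul (hasTemperateGrowth_cexp_mul_I.comp h2)
  have h5 : packet Q P θ = _ := funext fun x => by
    rw [packet, Complex.exp_add, ← Complex.ofReal_exp]
  rw [h5]
  exact h4

theorem packet_differentiable (Q P : E2) (θ : ℝ) : Differentiable ℝ (packet Q P θ) :=
  (packet_hasTemperateGrowth Q P θ).1.differentiable (by simp)

theorem coord_differentiable (i : Fin 2) : Differentiable ℝ (fun x : E2 => ((x i : ℝ) : ℂ)) :=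
  (hasTemperateGrowth_coord i).1.differentiable (by simp)

theorem pd_packet (Q P : E2) (θ : ℝ) (i : Fin 2) :
    pd i (packet Q P θ) = fun x => (-((x i : ℂ) - Q i) + P i * I) * packet Q P θ x := by
  funext x
  refine pd_eq_of_hasLineDerivAt (packet_differentiable Q P θ x) ?_
  unfold HasLineDerivAt packet
  have hc : ∀ j, HasDerivAt (fun t : ℝ => (x + t • EuclideanSpace.single i (1 : ℝ)) j)
      (if j = i then 1 else 0) 0 := by
    intro j
    have : (fun t : ℝ => (x + t • EuclideanSpace.single i (1 : ℝ)) j) =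
        fun t : ℝ => x j + t * (if j = i then 1 else 0) := by
      funext t; simp
    rw [this]
    simpa using ((hasDerivAt_id (0 : ℝ)).mul_const (if j = i then (1 : ℝ) else 0)).const_add (x j)
  have h1 := (((((hc 0).sub_const (Q 0)).pow 2).add (((hc 1).sub_const (Q 1)).pow 2)).neg.div_const
    2).ofReal_comp
  have h2 := ((((hc 0).const_mul (P 0)).add ((hc 1).const_mul (P 1))).add_const θ).ofReal_comp
  have h3 := (h1.add (h2.mul_const I)).cexp
  refine h3.congr_deriv ?_
  simp only [Pi.add_apply, Pi.neg_apply, Pi.pow_apply, zero_smul, add_zero]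
  rw [mul_comm]
  congr 1
  fin_cases i <;> simp <;> ring

theorem Aop_packet (Q P : E2) (θ : ℝ) (x : E2) :
    Aop (packet Q P θ) x = (2 + 2 * (x 0 * Q 0 + x 1 * Q 1 : ℂ) - (Q 0 ^ 2 + Q 1 ^ 2 : ℂ)
      + 2 * I * (P 0 * x 0 + P 1 * x 1) - 2 * I * (P 0 * Q 0 + P 1 * Q 1)
      + (P 0 ^ 2 + P 1 ^ 2)) * packet Q P θ x := by
  have h : ∀ i, pd i (pd i (packet Q P θ)) x =
      (-1 + (-((x i : ℂ) - Q i) + P i * I) ^ 2) * packet Q P θ x := by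
    intro i
    have hd : Differentiable ℝ (fun x : E2 => (-((x i : ℂ) - Q i) + P i * I)) :=
      ((coord_differentiable i).sub_const _).neg.add_const _
    have h1 : pd i (fun x : E2 => (-((x i : ℂ) - Q i) + P i * I)) x = -1 := by
      refine pd_eq_of_hasLineDerivAt (hd x) ?_
      have h2 : HasDerivAt (fun t : ℝ => x i + t) 1 0 := by
        simpa using (hasDerivAt_id (0 : ℝ)).const_add (x i)
      have h3 := (h2.sub_const (Q i)).ofReal_comp.neg.add_const (P i * I)
      have h4 : (fun t : ℝ => -(((x + t • EuclideanSpace.single i (1 : ℝ)) i : ℂ) - Q i) + P i * I)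
          = fun t : ℝ => -((x i + t - Q i : ℝ) : ℂ) + P i * I := by
        funext t; simp
      unfold HasLineDerivAt
      rw [h4]
      refine h3.congr_deriv ?_
      simp
    rw [pd_packet, pd_mul hd (packet_differentiable Q P θ), pd_packet]
    simp only [h1]
    ring
  rw [Aop, lap, Fin.sum_univ_two, h, h, ← ofReal_pow ‖x‖, norm_sq_E2]
  push_cast
  ring_nf
  simp only [I_sq]
  ring

theorem hasDerivAt_packet {Q P : ℝ → E2} {θ : ℝ → ℝ} {t : ℝ} {Q' P' : Fin 2 → ℝ} {θ' : ℝ}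
    (hQ : ∀ i, HasDerivAt (fun s => Q s i) (Q' i) t) (hP : ∀ i, HasDerivAt (fun s => P s i) (P' i) t)
    (hθ : HasDerivAt θ θ' t) (x : E2) :
    HasDerivAt (fun s => packet (Q s) (P s) (θ s) x)
      ((((x 0 - Q t 0) * Q' 0 + (x 1 - Q t 1) * Q' 1 : ℝ) + (P' 0 * x 0 + P' 1 * x 1 + θ' : ℝ) * I)
        * packet (Q t) (P t) (θ t) x) t := by
  have h1 := (((((hQ 0).const_sub (x 0)).pow 2).add (((hQ 1).const_sub (x 1)).pow 2)).neg.div_const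
    2).ofReal_comp
  have h2 := ((((hP 0).mul_const (x 0)).add ((hP 1).mul_const (x 1))).add hθ).ofReal_comp
  have h3 := (h1.add (h2.mul_const I)).cexp
  refine h3.congr_deriv ?_
  simp only [Pi.add_apply, Pi.neg_apply, Pi.pow_apply]
  rw [mul_comm]
  congr 1
  push_cast
  ring

/-- Position of the classical trajectory of the harmonic oscillator. -/
def flowQ (q p : E2) (t : ℝ) : E2 := Real.cos (2 * t) • q + Real.sin (2 * t) • p

/-- Momentum of the classical trajectory of the harmonic oscillator. -/
def flowP (q p : E2) (t : ℝ) : E2 := Real.cos (2 * t) • p - Real.sin (2 * t) • q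

/-- Phase of the coherent state. -/
def flowθ (q p : E2) (t : ℝ) : ℝ :=
  -(flowQ q p t 0 * flowP q p t 0 + flowQ q p t 1 * flowP q p t 1) / 2 - 2 * t

/-- The coherent state transported along the classical flow. -/
def coherent (q p : E2) (t : ℝ) : E2 → ℂ := packet (flowQ q p t) (flowP q p t) (flowθ q p t)

theorem hasDerivAt_flowQ (q p : E2) (t : ℝ) (i : Fin 2) :
    HasDerivAt (fun s => flowQ q p s i) (2 * flowP q p t i) t := by
  have h2 : HasDerivAt (fun s : ℝ => 2 * s) 2 t := by simpa using (hasDerivAt_id t).const_mul 2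
  have := (h2.cos.mul_const (q i)).add (h2.sin.mul_const (p i))
  refine (this.congr_deriv ?_)
  simp [flowP]
  ring

theorem hasDerivAt_flowP (q p : E2) (t : ℝ) (i : Fin 2) :
    HasDerivAt (fun s => flowP q p s i) (-2 * flowQ q p t i) t := by
  have h2 : HasDerivAt (fun s : ℝ => 2 * s) 2 t := by simpa using (hasDerivAt_id t).const_mul 2
  have := (h2.cos.mul_const (p i)).sub (h2.sin.mul_const (q i))
  refine (this.congr_deriv ?_)
  simp [flowQ]
  ring

theorem hasDerivAt_coherent (q p : E2) (t : ℝ) (x : E2) :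
    HasDerivAt (fun s => coherent q p s x) (-I * Aop (coherent q p t) x) t := by
  have hQ := hasDerivAt_flowQ q p t
  have hP := hasDerivAt_flowP q p t
  have hθ : HasDerivAt (flowθ q p) _ t :=
    (((((hQ 0).mul (hP 0)).add ((hQ 1).mul (hP 1))).neg.div_const 2).sub
      ((hasDerivAt_id t).const_mul 2))
  refine (hasDerivAt_packet (Q' := fun i => 2 * flowP q p t i) (P' := fun i => -2 * flowQ q p t i)
    hQ hP hθ x).congr_deriv ?_
  rw [coherent, Aop_packet]
  push_cast
  linear_combination (2 * (flowP q p t 0 * x 0 + flowP q p t 1 * x 1 - (flowP q p t 0 * flowQ q p t 0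
    + flowP q p t 1 * flowQ q p t 1)) * packet (flowQ q p t) (flowP q p t) (flowθ q p t) x : ℂ) * I_sq

section Param

theorem ContDiff.hasDerivAt_time {V F : Type*} [NormedAddCommGroup V] [NormedSpace ℝ V]
    [NormedAddCommGroup F] [NormedSpace ℝ F] {Φ : ℝ × V → F}
    (hΦ : ContDiff ℝ 1 Φ) (t : ℝ) (x : V) :
    HasDerivAt (fun s => Φ (s, x)) (fderiv ℝ Φ (t, x) (1, 0)) t := by
  have h1 := (hΦ.differentiable (by simp) (t, x)).hasFDerivAt
  exact h1.comp_hasDerivAt t ((hasDerivAt_id t).prodMk (hasDerivAt_const t x))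

/-- Differentiation under the integral sign for spatially compactly supported functions. -/
theorem hasDerivAt_integral_of_supported {Φ : ℝ × E2 → ℂ} (hΦ : ContDiff ℝ 1 Φ) {ρ : ℝ}
    (h0 : ∀ t x, ρ ≤ ‖x‖ → Φ (t, x) = 0) (t : ℝ) :
    HasDerivAt (fun s => ∫ x, Φ (s, x)) (∫ x, deriv (fun s => Φ (s, x)) t) t := by
  have hd := hΦ.hasDerivAt_time
  have hc : Continuous fun p : ℝ × E2 => fderiv ℝ Φ p (1, 0) :=
    (hΦ.continuous_fderiv (by simp)).clm_apply continuous_const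
  obtain ⟨C, hC⟩ := ((isCompact_closedBall t 1).prod (isCompact_closedBall (0 : E2) ρ)).exists_bound_of_continuousOn
    (f := fun p : ℝ × E2 => fderiv ℝ Φ p (1, 0)) hc.continuousOn
  have hz : ∀ s x, ρ ≤ ‖x‖ → fderiv ℝ Φ (s, x) (1, 0) = 0 := by
    intro s x hx
    rw [← (hd s x).deriv]
    simp [h0 _ x hx]
  simp only [(hd _ _).deriv]
  refine (hasDerivAt_integral_of_dominated_loc_of_deriv_le (F := fun s x => Φ (s, x))
    (F' := fun s x => fderiv ℝ Φ (s, x) (1, 0))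
    (bound := (Metric.closedBall (0 : E2) ρ).indicator fun _ => C)
    (Metric.ball_mem_nhds t one_pos) ?_ ?_ ?_ ?_ ?_ ?_).2
  · exact Filter.Eventually.of_forall fun s =>
      (hΦ.continuous.comp (Continuous.prodMk_right s)).aestronglyMeasurable
  · refine (hΦ.continuous.comp (Continuous.prodMk_right t)).integrable_of_hasCompactSupport ?_
    refine HasCompactSupport.intro (isCompact_closedBall (0 : E2) ρ) fun x hx => h0 t x ?_
    rw [mem_closedBall_zero_iff, not_le] at hx
    exact hx.le
  · exact (hc.comp (Continuous.prodMk_right t)).aestronglyMeasurable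
  · refine Filter.Eventually.of_forall fun x s hs => ?_
    by_cases hx : x ∈ Metric.closedBall (0 : E2) ρ
    · rw [Set.indicator_of_mem hx]
      exact hC (s, x) ⟨Metric.ball_subset_closedBall hs, hx⟩
    · rw [Set.indicator_of_notMem hx, hz, norm_zero]
      rw [mem_closedBall_zero_iff, not_le] at hx
      exact hx.le
  · exact (integrable_indicator_iff measurableSet_closedBall).2
      (integrableOn_const (measure_closedBall_lt_top).ne)
  · exact Filter.Eventually.of_forall fun x s _ => hd s x

end Param

theorem IsLinSolution.contDiff_one {w : ℝ → SchwartzMap E2 ℂ} (hw : IsLinSolution w) :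
    ContDiff ℝ 1 (fun p : ℝ × E2 => w p.1 p.2) := hw.1.of_le (by simp)

theorem IsLinSolution.exists_hasDerivAt {w : ℝ → SchwartzMap E2 ℂ} (hw : IsLinSolution w) (t : ℝ)
    (x : E2) : ∃ d, HasDerivAt (fun s => w s x) d t :=
  ⟨_, hw.contDiff_one.hasDerivAt_time t x⟩

theorem IsLinSolution.hasDerivAt {w : ℝ → SchwartzMap E2 ℂ} (hw : IsLinSolution w) (t : ℝ) (x : E2) :
    HasDerivAt (fun s => w s x) (I * Aop (fun y => w t y) x) t := by
  obtain ⟨d, h1⟩ := hw.exists_hasDerivAt t x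
  have h2 := hw.2 t x
  rw [h1.deriv] at h2
  refine h1.congr_deriv ?_
  unfold Aop
  linear_combination (-I) * h2 + d * I_sq

section Cutoff

theorem exists_cutoff : ∃ χ : E2 → ℂ, IsSchwartz χ ∧ (∀ x, ‖χ x‖ ≤ 1) ∧ (∀ x, ‖x‖ ≤ 1 → χ x = 1) ∧
    ∀ x, 2 ≤ ‖x‖ → χ x = 0 := by
  obtain ⟨f, hf1, hf2⟩ : ∃ f : ContDiffBump (0 : E2), f.rIn = 1 ∧ f.rOut = 2 :=
    ⟨⟨1, 2, one_pos, one_lt_two⟩, rfl, rfl⟩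
  have h0 : ∀ x : E2, 2 ≤ ‖x‖ → f x = 0 := fun x hx =>
    f.zero_of_le_dist (by rw [hf2, dist_zero_right]; exact hx)
  have hs : ContDiff ℝ (⊤ : ℕ∞) (fun x => (f x : ℂ)) :=
    Complex.ofRealCLM.contDiff.comp f.contDiff
  have hcs : HasCompactSupport (fun x => (f x : ℂ)) :=
    f.hasCompactSupport.comp_left Complex.ofReal_zero
  refine ⟨fun x => (f x : ℂ), ⟨hcs.toSchwartzMap hs, fun x => rfl⟩, fun x => ?_, fun x hx => ?_,
    fun x hx => ?_⟩
  · rw [norm_real, Real.norm_of_nonneg f.nonneg]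
    exact f.le_one
  · change ((f x : ℝ) : ℂ) = 1
    rw [f.one_of_mem_closedBall (by rw [hf1, mem_closedBall_zero_iff]; exact hx), ofReal_one]
  · change ((f x : ℝ) : ℂ) = 0
    rw [h0 x hx, ofReal_zero]

theorem pd_comp_smul {f : E2 → ℂ} (hf : Differentiable ℝ f) (ε : ℝ) (i : Fin 2) :
    pd i (fun x => f (ε • x)) = fun x => ε * pd i f (ε • x) := by
  funext x
  have h1 : HasFDerivAt (fun x : E2 => ε • x) (ε • ContinuousLinearMap.id ℝ E2) x :=
    (hasFDerivAt_id x).const_smul ε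
  have h2 := (hf (ε • x)).hasFDerivAt.comp x h1
  have h3 : fderiv ℝ (fun x => f (ε • x)) x = _ := h2.fderiv
  rw [pd, h3]
  simp [pd]

theorem isSchwartz_comp_smul {f : E2 → ℂ} (hf : IsSchwartz f) {ε : ℝ} (hε : ε ≠ 0) :
    IsSchwartz (fun x => f (ε • x)) := by
  obtain ⟨F, hF⟩ := hf
  refine ⟨SchwartzMap.compCLMOfContinuousLinearEquiv ℝ
    (ContinuousLinearEquiv.smulLeft (M₁ := E2) (R₁ := ℝ) (Units.mk0 ε hε)) F, fun x => ?_⟩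
  exact hF (ε • x)

/-- The commutator of `A` with multiplication by `χ`. -/
theorem Aop_mul {χ G : E2 → ℂ} (hχ : IsSchwartz χ) (hG : ContDiff ℝ (⊤ : ℕ∞) G) (x : E2) :
    Aop (fun x => χ x * G x) x = χ x * Aop G x
      - ∑ i, (pd i (pd i χ) x * G x + 2 * (pd i χ x * pd i G x)) := by
  have hG1 : Differentiable ℝ G := hG.differentiable (by simp)
  have hG2 : ∀ i, Differentiable ℝ (pd i G) := fun i =>
    ((hG.fderiv_right (m := (⊤ : ℕ∞)) (by simp)).clm_apply contDiff_const).differentiable (by simp)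
  have h : ∀ i, pd i (pd i (fun x => χ x * G x)) x = pd i (pd i χ) x * G x
      + 2 * (pd i χ x * pd i G x) + χ x * pd i (pd i G) x := by
    intro i
    rw [pd_mul hχ.differentiable hG1,
      pd_add ((hχ.pd i).differentiable.fun_mul hG1) (hχ.differentiable.fun_mul (hG2 i)),
      pd_mul (hχ.pd i).differentiable hG1, pd_mul hχ.differentiable (hG2 i)]
    ring
  simp only [Aop, lap, Fin.sum_univ_two, h]
  ring

end Cutoff

theorem contDiff_coherent (q p : E2) :
    ContDiff ℝ 1 (fun z : ℝ × E2 => coherent q p z.1 z.2) := by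
  have hx : ∀ i : Fin 2, ContDiff ℝ 1 (fun z : ℝ × E2 => z.2 i) := fun i =>
    (EuclideanSpace.proj i : E2 →L[ℝ] ℝ).contDiff.comp contDiff_snd
  have hc : ContDiff ℝ 1 (fun z : ℝ × E2 => Real.cos (2 * z.1)) := by fun_prop
  have hs : ContDiff ℝ 1 (fun z : ℝ × E2 => Real.sin (2 * z.1)) := by fun_prop
  have hQ : ∀ i : Fin 2, ContDiff ℝ 1 (fun z : ℝ × E2 => flowQ q p z.1 i) := fun i =>
    (hc.mul contDiff_const).add (hs.mul contDiff_const)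
  have hP : ∀ i : Fin 2, ContDiff ℝ 1 (fun z : ℝ × E2 => flowP q p z.1 i) := fun i =>
    (hc.mul contDiff_const).sub (hs.mul contDiff_const)
  have h1 := ((((hx 0).sub (hQ 0)).pow 2).add (((hx 1).sub (hQ 1)).pow 2)).neg.div_const 2
  have h2 := (((hP 0).mul (hx 0)).add ((hP 1).mul (hx 1))).add
    (((((hQ 0).mul (hP 0)).add ((hQ 1).mul (hP 1))).neg.div_const 2).sub
      (contDiff_const.mul contDiff_fst : ContDiff ℝ 1 (fun z : ℝ × E2 => 2 * z.1)))
  exact ((Complex.ofRealCLM.contDiff.comp h1).add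
    ((Complex.ofRealCLM.contDiff.comp h2).mul contDiff_const)).cexp

theorem norm_flowP_le (q p : E2) (t : ℝ) : ‖flowP q p t‖ ≤ ‖q‖ + ‖p‖ := by
  refine (norm_sub_le _ _).trans ?_
  rw [norm_smul, norm_smul, add_comm]
  exact add_le_add (mul_le_of_le_one_left (norm_nonneg _) (Real.abs_sin_le_one _))
    (mul_le_of_le_one_left (norm_nonneg _) (Real.abs_cos_le_one _))

theorem abs_coord_le (x : E2) (i : Fin 2) : |x i| ≤ ‖x‖ := PiLp.norm_apply_le x i

theorem norm_pd_packet_le (Q P : E2) (θ : ℝ) (i : Fin 2) (x : E2) :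
    ‖pd i (packet Q P θ) x‖ ≤ (‖x - Q‖ + ‖P‖) * Real.exp (-‖x - Q‖ ^ 2 / 2) := by
  rw [pd_packet, norm_mul, norm_packet]
  gcongr
  refine (norm_add_le _ _).trans (add_le_add ?_ ?_)
  · rw [norm_neg, ← ofReal_sub, norm_real]
    exact abs_coord_le (x - Q) i
  · rw [norm_mul, norm_I, mul_one, norm_real]
    exact abs_coord_le P i

theorem integrable_gaussian : Integrable (fun x : E2 => Real.exp (-‖x‖ ^ 2 / 2)) := by
  have := (GaussianFourier.integrable_cexp_neg_mul_sq_norm_add (V := E2) (b := 1 / 2) (by simp) 0 0).norm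
  refine this.congr (Filter.Eventually.of_forall fun x => ?_)
  simp only [norm_exp]
  congr 1
  simp
  rw [← ofReal_pow, ofReal_re]
  ring

/-- Bound for the commutator error of a truncated wave packet. -/
theorem norm_commutator_le {χ : E2 → ℂ} {B : ℝ} (hB1 : ∀ i x, ‖pd i χ x‖ ≤ B)
    (hB2 : ∀ i x, ‖pd i (pd i χ) x‖ ≤ B) (Q P : E2) (θ : ℝ) (x : E2) :
    ‖∑ i, (pd i (pd i χ) x * packet Q P θ x + 2 * (pd i χ x * pd i (packet Q P θ) x))‖ ≤
      B * ((6 + 4 * ‖P‖) * Real.exp (-‖x - Q‖ ^ 2 / 4)) := by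
  have hB : 0 ≤ B := (norm_nonneg _).trans (hB1 0 0)
  set r := ‖x - Q‖
  have hr : 0 ≤ r := norm_nonneg _
  have h : ∀ i, ‖pd i (pd i χ) x * packet Q P θ x + 2 * (pd i χ x * pd i (packet Q P θ) x)‖ ≤
      B * Real.exp (-r ^ 2 / 2) + 2 * (B * ((r + ‖P‖) * Real.exp (-r ^ 2 / 2))) := by
    intro i
    refine (norm_add_le _ _).trans ?_
    rw [norm_mul, norm_mul, norm_mul, norm_packet]
    gcongr
    · exact hB2 i x
    · simp
    · exact hB1 i x
    · exact norm_pd_packet_le Q P θ i x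
  refine (norm_sum_le _ _).trans ?_
  rw [Fin.sum_univ_two]
  refine (add_le_add (h 0) (h 1)).trans ?_
  have e : Real.exp (-r ^ 2 / 2) = Real.exp (-r ^ 2 / 4) * Real.exp (-r ^ 2 / 4) := by
    rw [← Real.exp_add]; ring_nf
  set E := Real.exp (-r ^ 2 / 4) with hE
  have hE0 : 0 < E := Real.exp_pos _
  have hE1 : E ≤ 1 := Real.exp_le_one_iff.2 (by nlinarith)
  have hrE : r * E ≤ 1 := by
    have h1 : r ≤ Real.exp (r ^ 2 / 4) := by
      have := Real.add_one_le_exp (r ^ 2 / 4)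
      nlinarith [sq_nonneg (r / 2 - 1)]
    calc r * E ≤ Real.exp (r ^ 2 / 4) * E := by gcongr
      _ = 1 := by rw [hE, ← Real.exp_add]; ring_nf; simp
  have h3 : (2 + 4 * r + 4 * ‖P‖) * E ≤ 6 + 4 * ‖P‖ := by
    nlinarith [mul_le_mul_of_nonneg_left hE1 (norm_nonneg P)]
  rw [e]
  calc _ = B * (((2 + 4 * r + 4 * ‖P‖) * E) * E) := by ring
    _ ≤ _ := by gcongr

theorem pd_packet_hasTemperateGrowth (Q P : E2) (θ : ℝ) (i : Fin 2) :
    (pd i (packet Q P θ)).HasTemperateGrowth := by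
  rw [pd_packet]
  have h1 := hasTemperateGrowth_coord i
  have h2 := packet_hasTemperateGrowth Q P θ
  have h3 : (fun x : E2 => packet Q P θ x).HasTemperateGrowth := h2
  have h4 : (fun _ : E2 => ((Q i : ℝ) : ℂ)).HasTemperateGrowth := .const _
  have h5 : (fun _ : E2 => ((P i : ℝ) : ℂ) * I).HasTemperateGrowth := .const _
  exact (((h1.sub h4).neg).add h5).mul h3

/-- The evolution law of the truncated pairing of a solution with a coherent state. -/
theorem IsLinSolution.hasDerivAt_truncated_pairing {w : ℝ → SchwartzMap E2 ℂ} (hw : IsLinSolution w)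
    (q p : E2) {S : E2 → ℂ} (hS : IsSchwartz S) {ρ : ℝ} (hS0 : ∀ x, ρ ≤ ‖x‖ → S x = 0) (τ : ℝ) :
    HasDerivAt (fun t => ∫ x, S x * (w t x * coherent q p t x))
      (-I * ∫ x, w τ x * ∑ i, (pd i (pd i S) x * coherent q p τ x
        + 2 * (pd i S x * pd i (coherent q p τ) x))) τ := by
  have h1 : ContDiff ℝ 1 (fun z : ℝ × E2 => S z.2 * (w z.1 z.2 * coherent q p z.1 z.2)) :=
    ((hS.contDiff.of_le (by simp)).comp contDiff_snd).mul (hw.contDiff_one.mul (contDiff_coherent q p))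
  have h2 := hasDerivAt_integral_of_supported h1 (ρ := ρ) (fun t x hx => by
    simp only [hS0 x hx, zero_mul]) τ
  refine h2.congr_deriv ?_
  have hG : (coherent q p τ).HasTemperateGrowth := packet_hasTemperateGrowth ..
  have hSG : IsSchwartz (fun x => S x * coherent q p τ x) := (hS.tmul hG).congr fun x => mul_comm _ _
  have hws := (w τ).isSchwartz
  have hA := Aop_mul hS hG.1
  have h3 : ∀ x, deriv (fun s => S x * (w s x * coherent q p s x)) τ =
      I * (Aop (fun y => w τ y) x * (S x * coherent q p τ x)) - I * (w τ x *
        (S x * Aop (coherent q p τ) x)) := by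
    intro x
    have := ((hw.hasDerivAt τ x).fun_mul (hasDerivAt_coherent q p τ x)).const_mul (S x)
    rw [this.deriv]
    ring
  have h5 : ∀ i, IsSchwartz fun x => pd i (pd i S) x * coherent q p τ x
      + 2 * (pd i S x * pd i (coherent q p τ) x) := fun i =>
    ((((hS.pd i).pd i).tmul hG).add (((hS.pd i).tmul
      (pd_packet_hasTemperateGrowth (flowQ q p τ) (flowP q p τ) (flowθ q p τ) i)).const_mul 2)).congr
      fun x => by simp only [coherent]; ring
  have h4 : IsSchwartz fun x => S x * Aop (coherent q p τ) x :=
    (hSG.Aop.add ((h5 0).add (h5 1))).congr fun x => by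
      rw [hA, Fin.sum_univ_two]; ring
  simp only
  simp_rw [h3]
  rw [integral_sub ((hws.Aop.mul hSG).const_mul I).integrable ((hws.mul h4).const_mul I).integrable,
    integral_const_mul, integral_const_mul, integral_Aop_mul hws hSG, ← mul_sub,
    ← integral_sub (hws.mul hSG.Aop).integrable (hws.mul h4).integrable, neg_mul, ← mul_neg,
    ← integral_neg]
  congr 2
  funext x
  rw [hA]
  ring

/-- Bounded mass forces conservation of the pairing with coherent states. -/
theorem IsLinSolution.integral_coherent_eq {w : ℝ → SchwartzMap E2 ℂ} (hw : IsLinSolution w)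
    {a b K : ℝ} (hK : ∀ t ∈ Set.Icc a b, ∫ x, ‖w t x‖ ^ 2 ≤ K) (q p : E2) {s t : ℝ}
    (hs : s ∈ Set.Icc a b) (ht : t ∈ Set.Icc a b) :
    ∫ x, w s x * coherent q p s x = ∫ x, w t x * coherent q p t x := by
  obtain ⟨χ, hχ, hχ1, hχone, hχ0⟩ := exists_cutoff
  obtain ⟨B, hB1, hB2⟩ : ∃ B, (∀ i x, ‖pd i χ x‖ ≤ B) ∧ ∀ i x, ‖pd i (pd i χ) x‖ ≤ B := by
    choose B1 h1 using fun i => (hχ.pd i).bdd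
    choose B2 h2 using fun i => ((hχ.pd i).pd i).bdd
    refine ⟨max (max (B1 0) (B1 1)) (max (B2 0) (B2 1)), fun i x => (h1 i x).trans ?_,
      fun i x => (h2 i x).trans ?_⟩ <;> fin_cases i <;> simp
  have hB : 0 ≤ B := (norm_nonneg _).trans (hB1 0 0)
  set L := 6 + 4 * (‖q‖ + ‖p‖) with hL
  set J := ∫ x : E2, Real.exp (-‖x‖ ^ 2 / 2)
  set c : ℝ → ℝ → ℂ := fun ε t => ∫ x, χ (ε • x) * (w t x * coherent q p t x) with hc
  have hbound : ∀ ε, 0 < ε → ε ≤ 1 → ‖c ε t - c ε s‖ ≤ ε * (B * (K + L ^ 2 * J)) * ‖t - s‖ := by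
    intro ε hε hε1
    have hS := isSchwartz_comp_smul hχ hε.ne'
    refine Convex.norm_image_sub_le_of_norm_hasDerivWithin_le (s := Set.Icc a b)
      (fun τ hτ => (hw.hasDerivAt_truncated_pairing q p hS (ρ := 2 / ε) (fun x hx => hχ0 _ (by
        rw [norm_smul, Real.norm_of_nonneg hε.le]
        rwa [div_le_iff₀' hε] at hx)) τ).hasDerivWithinAt) (fun τ hτ => ?_) (convex_Icc a b) hs ht
    have e1 : ∀ i, pd i (fun x => χ (ε • x)) = fun x => ε * pd i χ (ε • x) :=
      fun i => pd_comp_smul hχ.differentiable ε i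
    have e2 : ∀ i, pd i (pd i (fun x => χ (ε • x))) = fun x => ε * (ε * pd i (pd i χ) (ε • x)) := by
      intro i
      have := pd_comp_smul (hχ.pd i).differentiable ε i
      rw [e1, pd_mul (differentiable_const _)
        (isSchwartz_comp_smul (hχ.pd i) hε.ne').differentiable, this]
      funext x
      simp [pd]
    have hb1 : ∀ i x, ‖pd i (fun x => χ (ε • x)) x‖ ≤ ε * B := fun i x => by
      rw [e1, norm_mul, norm_real, Real.norm_of_nonneg hε.le]
      gcongr; exact hB1 _ _
    have hb2 : ∀ i x, ‖pd i (pd i (fun x => χ (ε • x))) x‖ ≤ ε * B := fun i x => by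
      rw [e2, norm_mul, norm_mul, norm_real, Real.norm_of_nonneg hε.le]
      gcongr
      exact (mul_le_of_le_one_left (norm_nonneg _) hε1).trans (hB2 _ _)
    rw [norm_mul, norm_neg, norm_I, one_mul]
    have hJ : ∫ x, Real.exp (-‖x - flowQ q p τ‖ ^ 2 / 2) = J :=
      integral_sub_right_eq_self (fun x : E2 => Real.exp (-‖x‖ ^ 2 / 2)) _
    have hJi : Integrable fun x => Real.exp (-‖x - flowQ q p τ‖ ^ 2 / 2) :=
      integrable_gaussian.comp_sub_right _
    have hwi := ((w τ).isSchwartz.integrable_normSq (μ := volume))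
    calc _ ≤ ∫ x, ε * B * (‖w τ x‖ ^ 2 + L ^ 2 * Real.exp (-‖x - flowQ q p τ‖ ^ 2 / 2)) := by
          refine norm_integral_le_of_norm_le ((hwi.add (hJi.const_mul _)).const_mul _)
            (Filter.Eventually.of_forall fun x => ?_)
          rw [norm_mul]
          have h6 := norm_commutator_le hb1 hb2 (flowQ q p τ) (flowP q p τ) (flowθ q p τ) x
          have h7 : (6 + 4 * ‖flowP q p τ‖) ≤ L := by
            have := norm_flowP_le q p τ
            rw [hL]; gcongr
          have h8 : Real.exp (-‖x - flowQ q p τ‖ ^ 2 / 2) =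
              Real.exp (-‖x - flowQ q p τ‖ ^ 2 / 4) ^ 2 := by
            rw [← Real.exp_nat_mul]; push_cast; ring_nf
          rw [h8]
          set e := Real.exp (-‖x - flowQ q p τ‖ ^ 2 / 4)
          have he : 0 < e := Real.exp_pos _
          calc _ ≤ ‖w τ x‖ * (ε * B * (L * e)) := by
                gcongr
                exact h6.trans (by gcongr)
            _ = ε * B * (‖w τ x‖ * (L * e)) := by ring
            _ ≤ _ := by
                gcongr
                nlinarith [sq_nonneg (‖w τ x‖ - L * e), sq_nonneg (‖w τ x‖), sq_nonneg (L * e)]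
      _ = ε * B * ((∫ x, ‖w τ x‖ ^ 2) + L ^ 2 * J) := by
          rw [integral_const_mul, integral_add hwi (hJi.const_mul _), integral_const_mul, hJ]
      _ ≤ ε * B * (K + L ^ 2 * J) := by gcongr; exact hK τ hτ
      _ = _ := by ring
  have hlim : ∀ τ, Filter.Tendsto (fun n : ℕ => c (1 / ((n : ℝ) + 1)) τ) Filter.atTop
      (nhds (∫ x, w τ x * coherent q p τ x)) := by
    intro τ
    refine tendsto_integral_of_dominated_convergence (fun x => ‖w τ x‖) (fun n => ?_)
      (w τ).isSchwartz.integrable.norm (fun n => Filter.Eventually.of_forall fun x => ?_)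
      (Filter.Eventually.of_forall fun x => ?_)
    · have hcc : Continuous (coherent q p τ) :=
        (packet_differentiable (flowQ q p τ) (flowP q p τ) (flowθ q p τ)).continuous
      exact ((hχ.continuous.comp (continuous_const_smul _)).mul
        ((w τ).continuous.mul hcc)).aestronglyMeasurable
    · have h9 : ‖coherent q p τ x‖ ≤ 1 := by
        rw [coherent, norm_packet, Real.exp_le_one_iff]
        nlinarith [sq_nonneg ‖x - flowQ q p τ‖]
      rw [norm_mul, norm_mul]
      calc _ ≤ 1 * (‖w τ x‖ * 1) := by gcongr; exact hχ1 _
        _ = _ := by ring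
    · have h0 : Filter.Tendsto (fun n : ℕ => (1 / ((n : ℝ) + 1)) • x) Filter.atTop (nhds ((0 : ℝ) • x)) :=
        tendsto_one_div_add_atTop_nhds_zero_nat.smul_const x
      have h1 := (hχ.continuous.tendsto _).comp h0
      rw [zero_smul, hχone 0 (by simp)] at h1
      simpa using h1.mul_const (w τ x * coherent q p τ x)
  have h0 : Filter.Tendsto (fun n : ℕ => c (1 / ((n : ℝ) + 1)) t - c (1 / ((n : ℝ) + 1)) s)
      Filter.atTop (nhds 0) := by
    refine squeeze_zero_norm (fun n => hbound _ (by positivity) ?_) ?_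
    · rw [div_le_one (by positivity)]; linarith [(Nat.cast_nonneg n : (0 : ℝ) ≤ n)]
    · simpa using ((tendsto_one_div_add_atTop_nhds_zero_nat (𝕜 := ℝ)).mul_const
        (B * (K + L ^ 2 * J))).mul_const ‖t - s‖
  have := tendsto_nhds_unique h0 ((hlim t).sub (hlim s))
  exact (sub_eq_zero.1 this.symm).symm

/-- Rotation in phase space. -/
def phaseRotation (c s : ℝ) : E2 × E2 →ₗ[ℝ] E2 × E2 :=
  (c • LinearMap.fst ℝ E2 E2 + s • LinearMap.snd ℝ E2 E2).prod
    (c • LinearMap.snd ℝ E2 E2 - s • LinearMap.fst ℝ E2 E2)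

theorem phaseRotation_apply (c s : ℝ) (z : E2 × E2) :
    phaseRotation c s z = (c • z.1 + s • z.2, c • z.2 - s • z.1) := rfl

theorem norm_sq_phaseRotation {c s : ℝ} (h : c ^ 2 + s ^ 2 = 1) (z : E2 × E2) :
    ‖(phaseRotation c s z).1‖ ^ 2 + ‖(phaseRotation c s z).2‖ ^ 2 = ‖z.1‖ ^ 2 + ‖z.2‖ ^ 2 := by
  simp only [norm_sq_E2, phaseRotation_apply, PiLp.add_apply, PiLp.sub_apply, PiLp.smul_apply,
    smul_eq_mul]
  linear_combination (z.1 0 ^ 2 + z.1 1 ^ 2 + z.2 0 ^ 2 + z.2 1 ^ 2) * h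

theorem measurePreserving_phaseRotation {c s : ℝ} (h : c ^ 2 + s ^ 2 = 1) :
    MeasurePreserving (phaseRotation c s) volume volume := by
  have : (volume : Measure (E2 × E2)).IsAddHaarMeasure := Measure.prod.instIsAddHaarMeasure _ _
  have hinv : phaseRotation c s ∘ₗ phaseRotation c (-s) = LinearMap.id := by
    refine LinearMap.ext fun z => ?_
    refine Prod.ext (PiLp.ext fun i => ?_) (PiLp.ext fun i => ?_) <;>
    simp only [phaseRotation_apply, LinearMap.comp_apply, LinearMap.id_apply, PiLp.add_apply,
      PiLp.sub_apply, PiLp.smul_apply, smul_eq_mul]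
    · linear_combination z.1 i * h
    · linear_combination z.2 i * h
  have hdet : LinearMap.det (phaseRotation c s) ≠ 0 := by
    intro h0
    have := congrArg LinearMap.det hinv
    rw [LinearMap.det_comp, h0, zero_mul, LinearMap.det_id] at this
    exact zero_ne_one this
  set D : Set (E2 × E2) := {z | ‖z.1‖ ^ 2 + ‖z.2‖ ^ 2 ≤ 1} with hD
  have hpre : phaseRotation c s ⁻¹' D = D := by
    ext z
    simp only [hD, Set.mem_preimage, Set.mem_ofPred_eq, norm_sq_phaseRotation h]
  have hne : volume D ≠ 0 := by
    refine (lt_of_lt_of_le (Metric.measure_ball_pos volume (0 : E2 × E2) (r := 1 / 2) (by norm_num))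
      (measure_mono fun z hz => ?_)).ne'
    rw [mem_ball_zero_iff, Prod.norm_def, max_lt_iff] at hz
    simp only [hD, Set.mem_ofPred_eq]
    nlinarith [norm_nonneg z.1, norm_nonneg z.2]
  have htop : volume D ≠ ⊤ := by
    refine (lt_of_le_of_lt (measure_mono fun z hz => ?_)
      (measure_closedBall_lt_top (x := (0 : E2 × E2)) (r := 1))).ne
    simp only [hD, Set.mem_ofPred_eq] at hz
    rw [mem_closedBall_zero_iff, Prod.norm_def, max_le_iff]
    constructor <;> nlinarith [norm_nonneg z.1, norm_nonneg z.2]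
  have h1 := Measure.addHaar_preimage_linearMap (volume : Measure (E2 × E2)) hdet D
  rw [hpre] at h1
  have h2 : ENNReal.ofReal |(LinearMap.det (phaseRotation c s))⁻¹| = 1 := by
    have h3 : 1 * volume D = ENNReal.ofReal |(LinearMap.det (phaseRotation c s))⁻¹| * volume D := by
      rw [one_mul]; exact h1
    exact ((ENNReal.mul_left_inj hne htop).1 h3).symm
  refine ⟨(LinearMap.continuous_of_finiteDimensional _).measurable, ?_⟩
  rw [Measure.map_linearMap_addHaar_eq_smul_addHaar _ hdet, h2, one_smul]

/-- The phase space transform of `f` with respect to Gaussian wave packets. -/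
def gabor (f : E2 → ℂ) (z : E2 × E2) : ℂ := ∫ x, f x * packet z.1 z.2 0 x

theorem packet_eq (Q P : E2) (θ : ℝ) (x : E2) :
    packet Q P θ x = packet Q P 0 x * cexp (θ * I) := by
  rw [packet, packet, ← Complex.exp_add]
  congr 1
  push_cast
  ring

theorem norm_integral_packet (f : E2 → ℂ) (Q P : E2) (θ : ℝ) :
    ‖∫ x, f x * packet Q P θ x‖ = ‖gabor f (Q, P)‖ := by
  have : ∀ x, f x * packet Q P θ x = (f x * packet Q P 0 x) * cexp (θ * I) := fun x => by
    rw [packet_eq]; ring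
  simp_rw [this]
  rw [integral_mul_const, norm_mul, norm_exp_ofReal_mul_I, mul_one]
  rfl

theorem norm_packet_le_one (Q P : E2) (θ : ℝ) (x : E2) : ‖packet Q P θ x‖ ≤ 1 := by
  rw [norm_packet, Real.exp_le_one_iff]
  nlinarith [sq_nonneg ‖x - Q‖]

theorem continuous_gabor {f : E2 → ℂ} (hf : IsSchwartz f) : Continuous (gabor f) := by
  refine continuous_of_dominated (bound := fun x => ‖f x‖) (fun z => ?_) (fun z => ?_)
    hf.integrable.norm ?_
  · exact (hf.continuous.mul (packet_differentiable _ _ _).continuous).aestronglyMeasurable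
  · refine Filter.Eventually.of_forall fun x => ?_
    rw [norm_mul]
    exact mul_le_of_le_one_right (norm_nonneg _) (norm_packet_le_one ..)
  · refine Filter.Eventually.of_forall fun x => ?_
    unfold packet
    fun_prop

theorem integrable_gaussian_one : Integrable (fun x : E2 => Real.exp (-‖x‖ ^ 2)) := by
  have := (GaussianFourier.integrable_cexp_neg_mul_sq_norm_add (V := E2) (b := 1) (by simp) 0 0).norm
  refine this.congr (Filter.Eventually.of_forall fun x => ?_)
  simp only [norm_exp]
  congr 1
  simp
  rw [← ofReal_pow, ofReal_re]

theorem gabor_slice {f : E2 → ℂ} (hf : IsSchwartz f) (q : E2) :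
    Integrable (fun p => ‖gabor f (q, p)‖ ^ 2) ∧
    ∫ p, ‖gabor f (q, p)‖ ^ 2 = (2 * Real.pi) ^ 2 * ∫ x, ‖f x‖ ^ 2 * Real.exp (-‖x - q‖ ^ 2) := by
  obtain ⟨F, hF⟩ := hf.tmul (packet_hasTemperateGrowth q 0 0)
  have hG : ∀ p, gabor f (q, p) = FourierTransform.fourier F (-(2 * Real.pi)⁻¹ • p) := by
    intro p
    rw [SchwartzMap.fourier_coe, Real.fourier_eq', gabor]
    refine integral_congr_ae (Filter.Eventually.of_forall fun x => ?_)
    simp only [smul_eq_mul]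
    rw [hF]
    unfold packet
    rw [mul_comm (f x), ← mul_assoc, ← Complex.exp_add]
    congr 2
    have e : -2 * Real.pi * inner ℝ x (-(2 * Real.pi)⁻¹ • p) = p 0 * x 0 + p 1 * x 1 := by
      rw [inner_smul_right, PiLp.inner_apply, Fin.sum_univ_two]
      simp only [RCLike.inner_apply, conj_trivial]
      field_simp
    rw [e]
    push_cast
    simp
    ring
  have h1 := (FourierTransform.fourier F).isSchwartz.integrable_normSq (μ := volume)
  have hpi : -(2 * Real.pi)⁻¹ ≠ 0 := by simp [Real.pi_ne_zero]
  refine ⟨?_, ?_⟩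
  · simp_rw [hG]
    exact h1.comp_smul hpi
  · simp_rw [hG]
    rw [Measure.integral_comp_smul volume
      (fun p => ‖FourierTransform.fourier F p‖ ^ 2), SchwartzMap.integral_norm_sq_fourier]
    simp only [finrank_euclideanSpace, Fintype.card_fin, smul_eq_mul]
    congr 1
    · rw [neg_sq, inv_pow, inv_inv, abs_of_nonneg (by positivity)]
    · refine integral_congr_ae (Filter.Eventually.of_forall fun x => ?_)
      simp only
      rw [hF, norm_mul, norm_packet, mul_pow, mul_comm, ← Real.exp_nat_mul]
      congr 2
      push_cast
      ring

theorem lintegral_gabor {f : E2 → ℂ} (hf : IsSchwartz f) :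
    ∫⁻ z, ENNReal.ofReal (‖gabor f z‖ ^ 2) = ENNReal.ofReal
      ((2 * Real.pi) ^ 2 * ((∫ x : E2, Real.exp (-‖x‖ ^ 2)) * ∫ x, ‖f x‖ ^ 2)) := by
  set J := ∫ x : E2, Real.exp (-‖x‖ ^ 2) with hJ
  have hJ0 : 0 ≤ J := integral_nonneg fun x => (Real.exp_pos _).le
  have hn := hf.integrable_normSq (μ := volume)
  obtain ⟨B, hB⟩ := hf.bdd
  have hi : ∀ q, Integrable fun x => ‖f x‖ ^ 2 * Real.exp (-‖x - q‖ ^ 2) := fun q => by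
    refine hn.mul_bdd (c := 1) (by fun_prop) (Filter.Eventually.of_forall fun x => ?_)
    rw [Real.norm_of_nonneg (Real.exp_pos _).le, Real.exp_le_one_iff]
    nlinarith [sq_nonneg ‖x - q‖]
  have hm : Measurable fun z : E2 × E2 => ENNReal.ofReal (‖gabor f z‖ ^ 2) :=
    (((continuous_gabor hf).norm.pow 2).measurable).ennreal_ofReal
  have hcf := hf.continuous
  rw [Measure.volume_eq_prod, lintegral_prod _ hm.aemeasurable]
  have h1 : ∀ q, ∫⁻ p, ENNReal.ofReal (‖gabor f (q, p)‖ ^ 2) = ENNReal.ofReal ((2 * Real.pi) ^ 2) *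
      ∫⁻ x, ENNReal.ofReal (‖f x‖ ^ 2 * Real.exp (-‖x - q‖ ^ 2)) := by
    intro q
    obtain ⟨h1, h2⟩ := gabor_slice hf q
    rw [← ofReal_integral_eq_lintegral_ofReal h1 (Filter.Eventually.of_forall fun p => by positivity),
      ← ofReal_integral_eq_lintegral_ofReal (hi q) (Filter.Eventually.of_forall fun p => by positivity),
      h2, ENNReal.ofReal_mul (by positivity)]
  simp_rw [h1]
  have hmm : Measurable fun z : E2 × E2 =>
      ENNReal.ofReal (‖f z.2‖ ^ 2 * Real.exp (-‖z.2 - z.1‖ ^ 2)) :=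
    (by fun_prop : Continuous fun z : E2 × E2 =>
      ‖f z.2‖ ^ 2 * Real.exp (-‖z.2 - z.1‖ ^ 2)).measurable.ennreal_ofReal
  rw [lintegral_const_mul _ hmm.lintegral_prod_right',
    lintegral_lintegral_swap (f := fun q x => ENNReal.ofReal (‖f x‖ ^ 2 * Real.exp (-‖x - q‖ ^ 2)))
      hmm.aemeasurable]
  have h2 : ∀ x, ∫⁻ q, ENNReal.ofReal (‖f x‖ ^ 2 * Real.exp (-‖x - q‖ ^ 2)) =
      ENNReal.ofReal (J * ‖f x‖ ^ 2) := by
    intro x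
    have h3 : Integrable fun q => ‖f x‖ ^ 2 * Real.exp (-‖x - q‖ ^ 2) :=
      (integrable_gaussian_one.comp_sub_left x).const_mul _
    rw [← ofReal_integral_eq_lintegral_ofReal h3 (Filter.Eventually.of_forall fun p => by positivity),
      integral_const_mul, integral_sub_left_eq_self (fun q : E2 => Real.exp (-‖q‖ ^ 2)), mul_comm]
  simp_rw [h2]
  rw [← ofReal_integral_eq_lintegral_ofReal (hn.const_mul J)
    (Filter.Eventually.of_forall fun p => by positivity), integral_const_mul,
    ← ENNReal.ofReal_mul (by positivity)]

theorem integral_gaussian_one_pos : 0 < ∫ x : E2, Real.exp (-‖x‖ ^ 2) := by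
  refine (integral_pos_iff_support_of_nonneg (fun x => (Real.exp_pos _).le)
    integrable_gaussian_one).2 ?_
  have : (Function.support fun x : E2 => Real.exp (-‖x‖ ^ 2)) = Set.univ := by
    ext x; simp [(Real.exp_pos _).ne']
  rw [this]
  simp

theorem IsLinSolution.mass_eq_of_bounded {w : ℝ → SchwartzMap E2 ℂ} (hw : IsLinSolution w)
    {a b K : ℝ} (hK : ∀ t ∈ Set.Icc a b, ∫ x, ‖w t x‖ ^ 2 ≤ K) {s t : ℝ}
    (hs : s ∈ Set.Icc a b) (ht : t ∈ Set.Icc a b) :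
    ∫ x, ‖w s x‖ ^ 2 = ∫ x, ‖w t x‖ ^ 2 := by
  have hcs : ∀ τ, Real.cos (2 * τ) ^ 2 + Real.sin (2 * τ) ^ 2 = 1 := fun τ =>
    Real.cos_sq_add_sin_sq _
  have h1 : ∀ τ, ∫⁻ z, ENNReal.ofReal (‖gabor (w τ)
      (phaseRotation (Real.cos (2 * τ)) (Real.sin (2 * τ)) z)‖ ^ 2) =
      ∫⁻ z, ENNReal.ofReal (‖gabor (w τ) z‖ ^ 2) := fun τ =>
    (measurePreserving_phaseRotation (hcs τ)).lintegral_comp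
      ((((continuous_gabor (w τ).isSchwartz).norm.pow 2).measurable).ennreal_ofReal)
  have h2 : ∀ τ z, ‖gabor (w τ) (phaseRotation (Real.cos (2 * τ)) (Real.sin (2 * τ)) z)‖ =
      ‖∫ x, w τ x * coherent z.1 z.2 τ x‖ := fun τ z => (norm_integral_packet _ _ _ _).symm
  have h3 := (h1 s).symm.trans (Eq.trans (by
    refine lintegral_congr fun z => ?_
    rw [h2, h2, hw.integral_coherent_eq hK z.1 z.2 hs ht]) (h1 t))
  rw [lintegral_gabor (w s).isSchwartz, lintegral_gabor (w t).isSchwartz] at h3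
  have hJ := integral_gaussian_one_pos
  have hnn : ∀ τ, 0 ≤ ∫ x, ‖w τ x‖ ^ 2 := fun τ => integral_nonneg fun x => by positivity
  rw [ENNReal.ofReal_eq_ofReal_iff (by have := hnn s; positivity) (by have := hnn t; positivity)] at h3
  exact mul_left_cancel₀ hJ.ne' (mul_left_cancel₀ (by positivity) h3)

theorem IsLinSolution.isClosed_mass_le {w : ℝ → SchwartzMap E2 ℂ} (hw : IsLinSolution w) (K : ℝ) :
    IsClosed {t | ∫ x, ‖w t x‖ ^ 2 ≤ K} := by
  have hnn : ∀ τ, 0 ≤ ∫ x, ‖w τ x‖ ^ 2 := fun τ => integral_nonneg fun x => by positivity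
  have he : ∀ τ, ENNReal.ofReal (∫ x, ‖w τ x‖ ^ 2) = ∫⁻ x, ENNReal.ofReal (‖w τ x‖ ^ 2) := fun τ =>
    ofReal_integral_eq_lintegral_ofReal (w τ).isSchwartz.integrable_normSq
      (Filter.Eventually.of_forall fun p => by positivity)
  refine IsSeqClosed.isClosed fun T t hT hTt => ?_
  have hK : 0 ≤ K := (hnn _).trans (hT 0)
  simp only [Set.mem_ofPred_eq] at hT ⊢
  rw [← ENNReal.ofReal_le_ofReal_iff hK, he]
  have hc : ∀ x, Filter.Tendsto (fun n => ENNReal.ofReal (‖w (T n) x‖ ^ 2)) Filter.atTop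
      (nhds (ENNReal.ofReal (‖w t x‖ ^ 2))) := fun x => by
    have h0 : Continuous fun s => w s x :=
      hw.1.continuous.comp (continuous_id.prodMk continuous_const)
    exact ((ENNReal.continuous_ofReal.comp (h0.norm.pow 2)).tendsto t).comp hTt
  calc _ = ∫⁻ x, Filter.liminf (fun n => ENNReal.ofReal (‖w (T n) x‖ ^ 2)) Filter.atTop :=
        lintegral_congr fun x => (hc x).liminf_eq.symm
    _ ≤ Filter.liminf (fun n => ∫⁻ x, ENNReal.ofReal (‖w (T n) x‖ ^ 2)) Filter.atTop :=
        lintegral_liminf_le fun n => ((w (T n)).continuous.norm.pow 2).measurable.ennreal_ofReal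
    _ ≤ Filter.liminf (fun _ : ℕ => ENNReal.ofReal K) Filter.atTop := by
        refine Filter.liminf_le_liminf (Filter.Eventually.of_forall fun n => ?_)
        rw [← he]
        exact ENNReal.ofReal_le_ofReal (hT n)
    _ = _ := by simp

/-- Conservation of mass. -/
theorem IsLinSolution.mass_eq {w : ℝ → SchwartzMap E2 ℂ} (hw : IsLinSolution w) (s t : ℝ) :
    ∫ x, ‖w s x‖ ^ 2 = ∫ x, ‖w t x‖ ^ 2 :=
  eq_of_isClosed_sublevel_of_const_of_bounded (P := fun t => ∫ x, ‖w t x‖ ^ 2)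
    hw.isClosed_mass_le (fun _ _ _ hK _ hs _ ht => hw.mass_eq_of_bounded hK hs ht) s t

section Slices

variable {Φ : ℝ × E2 → ℂ}

theorem pd_slice (hΦ : ContDiff ℝ 1 Φ) (i : Fin 2) (t : ℝ) (x : E2) :
    pd i (fun y => Φ (t, y)) x = fderiv ℝ Φ (t, x) (0, EuclideanSpace.single i 1) := by
  have h1 := (hΦ.differentiable (by simp) (t, x)).hasFDerivAt
  have h2 : HasFDerivAt (fun y : E2 => (t, y)) (ContinuousLinearMap.inr ℝ ℝ E2) x :=
    hasFDerivAt_prodMk_right t x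
  have h3 : fderiv ℝ (fun y => Φ (t, y)) x = _ := (h1.comp x h2).fderiv
  rw [pd, h3]
  rfl

theorem fderiv_fderiv_comm {V : Type*} [NormedAddCommGroup V] [NormedSpace ℝ V] {Φ : V → ℂ}
    (hΦ : ContDiff ℝ (⊤ : ℕ∞) Φ) (z u v : V) :
    fderiv ℝ (fun y => fderiv ℝ Φ y u) z v = fderiv ℝ (fun y => fderiv ℝ Φ y v) z u := by
  have hd : Differentiable ℝ (fderiv ℝ Φ) :=
    (hΦ.fderiv_right (m := (⊤ : ℕ∞)) (by simp)).differentiable (by simp)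
  have h : ∀ u v, fderiv ℝ (fun y => fderiv ℝ Φ y u) z v = fderiv ℝ (fderiv ℝ Φ) z v u := by
    intro u v
    rw [fderiv_clm_apply (hd z) (differentiableAt_const u)]
    simp
  rw [h, h]
  refine second_derivative_symmetric (f := Φ) (f' := fderiv ℝ Φ) (fun y => ?_) (hd z).hasFDerivAt v u
  exact (hΦ.differentiable (by simp) y).hasFDerivAt

theorem contDiff_pd_slice (hΦ : ContDiff ℝ (⊤ : ℕ∞) Φ) (i : Fin 2) :
    ContDiff ℝ (⊤ : ℕ∞) (fun z : ℝ × E2 => pd i (fun y => Φ (z.1, y)) z.2) := by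
  simp_rw [pd_slice (hΦ.of_le (by simp))]
  exact (hΦ.fderiv_right (m := (⊤ : ℕ∞)) (by simp)).clm_apply contDiff_const

theorem hasDerivAt_pd_slice (hΦ : ContDiff ℝ (⊤ : ℕ∞) Φ) (i : Fin 2) (t : ℝ) (x : E2) :
    HasDerivAt (fun s => pd i (fun y => Φ (s, y)) x)
      (pd i (fun y => deriv (fun s => Φ (s, y)) t) x) t := by
  have h := (((contDiff_pd_slice hΦ i).of_le (by simp : (1 : WithTop ℕ∞) ≤ _)).hasDerivAt_time t x)
  refine h.congr_deriv ?_
  have h1 : ContDiff ℝ 1 Φ := hΦ.of_le (by simp)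
  have e1 : (fun z : ℝ × E2 => pd i (fun y => Φ (z.1, y)) z.2) =
      fun z => fderiv ℝ Φ z (0, EuclideanSpace.single i 1) := funext fun z => pd_slice h1 i z.1 z.2
  have e2 : (fun y => deriv (fun s => Φ (s, y)) t) =
      fun y => (fun z => fderiv ℝ Φ z (1, 0)) (t, y) := funext fun y => (h1.hasDerivAt_time t y).deriv
  have h2 : ContDiff ℝ 1 (fun z => fderiv ℝ Φ z ((1, 0) : ℝ × E2)) :=
    ((hΦ.fderiv_right (m := (⊤ : ℕ∞)) (by simp)).clm_apply contDiff_const).of_le (by simp)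
  rw [e1, e2, pd_slice h2]
  exact fderiv_fderiv_comm hΦ _ _ _

end Slices

theorem pd_const_mul {f : E2 → ℂ} (hf : Differentiable ℝ f) (c : ℂ) (i : Fin 2) :
    pd i (fun x => c * f x) = fun x => c * pd i f x := by
  rw [pd_mul (differentiable_const c) hf]
  funext x
  simp [pd]

theorem Aop_const_mul {f : E2 → ℂ} (hf : IsSchwartz f) (c : ℂ) (x : E2) :
    Aop (fun y => c * f y) x = c * Aop f x := by
  have h : ∀ i, pd i (pd i (fun y => c * f y)) x = c * pd i (pd i f) x := fun i => by
    rw [pd_const_mul hf.differentiable, pd_const_mul (hf.pd i).differentiable]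
  simp only [Aop, lap, Fin.sum_univ_two, h]
  ring

theorem Aop_add {f g : E2 → ℂ} (hf : IsSchwartz f) (hg : IsSchwartz g) (x : E2) :
    Aop (fun y => f y + g y) x = Aop f x + Aop g x := by
  have h : ∀ i, pd i (pd i (fun y => f y + g y)) x = pd i (pd i f) x + pd i (pd i g) x := fun i => by
    rw [pd_add hf.differentiable hg.differentiable,
      pd_add (hf.pd i).differentiable (hg.pd i).differentiable]
  simp only [Aop, lap, Fin.sum_univ_two, h]
  ring

theorem isLinSolution_of_hasDerivAt {w : ℝ → SchwartzMap E2 ℂ}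
    (hw : ContDiff ℝ (⊤ : ℕ∞) (fun p : ℝ × E2 => w p.1 p.2))
    (h : ∀ t x, HasDerivAt (fun s => w s x) (I * Aop (fun y => w t y) x) t) : IsLinSolution w := by
  refine ⟨hw, fun t x => ?_⟩
  rw [(h t x).deriv, Aop]
  linear_combination (-lap (fun y => w t y) x + (‖x‖ : ℂ) ^ 2 * w t x) * I_mul_I

/-- The harmonic oscillator acting on Schwartz functions. -/
def schwartzAop (f : SchwartzMap E2 ℂ) : SchwartzMap E2 ℂ := f.isSchwartz.Aop.choose

theorem schwartzAop_apply (f : SchwartzMap E2 ℂ) (x : E2) :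
    schwartzAop f x = Aop (fun y => f y) x := f.isSchwartz.Aop.choose_spec x

theorem IsLinSolution.schwartzAop {w : ℝ → SchwartzMap E2 ℂ} (hw : IsLinSolution w) :
    IsLinSolution (fun t => schwartzAop (w t)) := by
  have e : ∀ t x, (_root_.schwartzAop (w t)) x = -(pd 0 (pd 0 (fun y => w t y)) x +
      pd 1 (pd 1 (fun y => w t y)) x) + (‖x‖ : ℂ) ^ 2 * w t x := fun t x => by
    rw [schwartzAop_apply, Aop, lap, Fin.sum_univ_two]
  have hp : ∀ i, ContDiff ℝ (⊤ : ℕ∞) (fun z : ℝ × E2 => pd i (fun y => w z.1 y) z.2) :=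
    fun i => contDiff_pd_slice hw.1 i
  have hpp : ∀ i, ContDiff ℝ (⊤ : ℕ∞) (fun z : ℝ × E2 => pd i (pd i (fun y => w z.1 y)) z.2) :=
    fun i => contDiff_pd_slice (hp i) i
  refine isLinSolution_of_hasDerivAt ?_ fun t x => ?_
  · simp_rw [e]
    have hn : ContDiff ℝ (⊤ : ℕ∞) (fun z : ℝ × E2 => (‖z.2‖ : ℂ) ^ 2) := by
      have : ContDiff ℝ (⊤ : ℕ∞) (fun z : ℝ × E2 => ((‖z.2‖ ^ 2 : ℝ) : ℂ)) :=
        Complex.ofRealCLM.contDiff.comp (contDiff_snd.norm_sq ℝ)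
      simpa using this
    exact ((hpp 0).add (hpp 1)).neg.add (hn.mul hw.1)
  · have hd : (fun y => deriv (fun s => w s y) t) = fun y => I * Aop (fun y => w t y) y :=
      funext fun y => (hw.hasDerivAt t y).deriv
    have h1 : ∀ i, HasDerivAt (fun s => pd i (pd i (fun y => w s y)) x)
        (pd i (pd i (fun y => I * Aop (fun y => w t y) y)) x) t := fun i => by
      have h2 : (fun y => deriv (fun s => pd i (fun y => w s y) y) t) =
          pd i (fun y => I * Aop (fun y => w t y) y) := funext fun y => by
        rw [← hd]; exact (hasDerivAt_pd_slice hw.1 i t y).deriv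
      have h3 := hasDerivAt_pd_slice (hp i) i t x
      simp only [h2] at h3
      exact h3
    have h4 := ((h1 0).fun_add (h1 1)).fun_neg.fun_add ((hw.hasDerivAt t x).const_mul ((‖x‖ : ℂ) ^ 2))
    have h5 : (fun y => (_root_.schwartzAop (w t)) y) = Aop (fun y => w t y) :=
      funext fun y => schwartzAop_apply _ _
    have hA := (w t).isSchwartz.Aop
    rw [h5, ← Aop_const_mul hA I]
    have h6 : (fun s => (_root_.schwartzAop (w s)) x) = _ := funext fun s => e s x
    rw [h6]
    refine h4.congr_deriv ?_
    simp only [Aop, lap, Fin.sum_univ_two, neg_add_rev]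

theorem IsLinSolution.add {w₁ w₂ : ℝ → SchwartzMap E2 ℂ} (h₁ : IsLinSolution w₁)
    (h₂ : IsLinSolution w₂) : IsLinSolution (fun t => w₁ t + w₂ t) := by
  refine isLinSolution_of_hasDerivAt (h₁.1.add h₂.1) fun t x => ?_
  have := (h₁.hasDerivAt t x).fun_add (h₂.hasDerivAt t x)
  rw [← mul_add, ← Aop_add (w₁ t).isSchwartz (w₂ t).isSchwartz] at this
  exact this

/-- The squared `ℋ¹` norm. -/
def energy (f : E2 → ℂ) : ℝ := (∫ x : E2, gradSq f x) + ∫ x : E2, ‖x‖ ^ 2 * ‖f x‖ ^ 2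

theorem pd_conj {f : E2 → ℂ} (hf : Differentiable ℝ f) (i : Fin 2) :
    pd i (fun x => (starRingEnd ℂ) (f x)) = fun x => (starRingEnd ℂ) (pd i f x) := by
  funext x
  have h := (Complex.conjCLE : ℂ →L[ℝ] ℂ).hasFDerivAt.comp x (hf x).hasFDerivAt
  have h3 : fderiv ℝ (fun x => (starRingEnd ℂ) (f x)) x = _ := h.fderiv
  rw [pd, h3]
  rfl

theorem conj_mul_self_eq (z : ℂ) : (starRingEnd ℂ) z * z = ((‖z‖ ^ 2 : ℝ) : ℂ) := by
  rw [conj_mul']; push_cast; rfl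

theorem integrable_norm_sq_mul_norm_sq {f : E2 → ℂ} (hf : IsSchwartz f) :
    Integrable (fun x => ‖x‖ ^ 2 * ‖f x‖ ^ 2) := by
  have := (hf.conj.mul hf.norm_sq_mul).integrable (μ := volume) |>.re
  refine this.congr (Filter.Eventually.of_forall fun x => ?_)
  have : (starRingEnd ℂ) (f x) * ((‖x‖ : ℂ) ^ 2 * f x) = ((‖x‖ ^ 2 * ‖f x‖ ^ 2 : ℝ) : ℂ) := by
    rw [mul_left_comm, conj_mul_self_eq]; push_cast; rfl
  simp only [this]
  rfl

theorem integral_conj_mul_Aop {f : E2 → ℂ} (hf : IsSchwartz f) :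
    ∫ x, (starRingEnd ℂ) (f x) * Aop f x = (energy f : ℂ) := by
  have h : ∀ i, ∫ x, (starRingEnd ℂ) (f x) * pd i (pd i f) x =
      -((∫ x, ‖pd i f x‖ ^ 2 : ℝ) : ℂ) := by
    intro i
    have h1 := integral_pd_mul hf.conj (hf.pd i) i
    rw [pd_conj hf.differentiable] at h1
    simp only [conj_mul_self_eq] at h1
    rw [integral_complex_ofReal] at h1
    rw [h1, neg_neg]
  have e : ∀ x, (starRingEnd ℂ) (f x) * Aop f x = -((starRingEnd ℂ) (f x) * pd 0 (pd 0 f) x) -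
      ((starRingEnd ℂ) (f x) * pd 1 (pd 1 f) x) + ((‖x‖ ^ 2 * ‖f x‖ ^ 2 : ℝ) : ℂ) := by
    intro x
    have := conj_mul_self_eq (f x)
    rw [Aop, lap, Fin.sum_univ_two]
    push_cast at this ⊢
    linear_combination (‖x‖ : ℂ) ^ 2 * this
  have i0 := hf.conj.mul ((hf.pd 0).pd 0)
  have i1 := hf.conj.mul ((hf.pd 1).pd 1)
  have hV : Integrable fun x => ((‖x‖ ^ 2 * ‖f x‖ ^ 2 : ℝ) : ℂ) :=
    (integrable_norm_sq_mul_norm_sq hf).ofReal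
  simp_rw [e]
  rw [integral_add (i0.neg.sub i1).integrable hV,
    integral_sub i0.neg.integrable i1.integrable, integral_neg, h, h, integral_complex_ofReal, energy]
  have : ∫ x, gradSq f x = (∫ x, ‖pd 0 f x‖ ^ 2) + ∫ x, ‖pd 1 f x‖ ^ 2 := by
    simp only [gradSq, Fin.sum_univ_two]
    exact integral_add (hf.pd 0).integrable_normSq (hf.pd 1).integrable_normSq
  rw [this]
  push_cast
  ring

theorem mass_add_Aop {f : E2 → ℂ} (hf : IsSchwartz f) :
    ∫ x, ‖f x + Aop f x‖ ^ 2 = (∫ x, ‖f x‖ ^ 2) + (∫ x, ‖Aop f x‖ ^ 2) + 2 * energy f := by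
  have e : ∀ x, ‖f x + Aop f x‖ ^ 2 = ‖f x‖ ^ 2 + ‖Aop f x‖ ^ 2 +
      2 * ((starRingEnd ℂ) (f x) * Aop f x).re := fun x => by
    rw [Complex.sq_norm, Complex.sq_norm, Complex.sq_norm, Complex.normSq_add, ← conj_re]
    simp
  have hc := (hf.conj.mul hf.Aop).integrable (μ := volume)
  have hre : ∫ x, ((starRingEnd ℂ) (f x) * Aop f x).re = energy f := by
    have h1 := integral_re hc
    have h2 := congrArg Complex.re (integral_conj_mul_Aop hf)
    rw [ofReal_re] at h2
    exact h1.trans h2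
  have hadd : Integrable fun x => ‖f x‖ ^ 2 + ‖Aop f x‖ ^ 2 :=
    hf.integrable_normSq.add hf.Aop.integrable_normSq
  have hri : Integrable fun x => ((starRingEnd ℂ) (f x) * Aop f x).re := hc.re
  simp_rw [e]
  rw [integral_add hadd (hri.const_mul 2),
    integral_add hf.integrable_normSq hf.Aop.integrable_normSq, integral_const_mul, hre]

/-- Conservation of energy. -/
theorem IsLinSolution.energy_eq {w : ℝ → SchwartzMap E2 ℂ} (hw : IsLinSolution w) (s t : ℝ) :
    energy (w s) = energy (w t) := by
  have h1 := hw.mass_eq s t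
  have h2 := hw.schwartzAop.mass_eq s t
  have h3 := (hw.add hw.schwartzAop).mass_eq s t
  simp only [add_apply, schwartzAop_apply] at h2 h3
  rw [mass_add_Aop (w s).isSchwartz, mass_add_Aop (w t).isSchwartz] at h3
  linarith

section Directional

variable {V : Type*} [NormedAddCommGroup V] [NormedSpace ℝ V]

/-- The derivative of `f` in the direction `v`. -/
def dd (v : V) (f : V → ℂ) : V → ℂ := fun x => fderiv ℝ f x v

theorem IsSchwartz.dd {f : V → ℂ} (hf : IsSchwartz f) (v : V) : IsSchwartz (dd v f) :=
  hf.fderiv_apply v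

theorem dd_conj {f : V → ℂ} (hf : Differentiable ℝ f) (v : V) :
    dd v (fun x => (starRingEnd ℂ) (f x)) = fun x => (starRingEnd ℂ) (dd v f x) := by
  funext x
  have h := (Complex.conjCLE : ℂ →L[ℝ] ℂ).hasFDerivAt.comp x (hf x).hasFDerivAt
  have h3 : fderiv ℝ (fun x => (starRingEnd ℂ) (f x)) x = _ := h.fderiv
  rw [dd, h3]
  rfl

theorem dd_mul {f g : V → ℂ} (hf : Differentiable ℝ f) (hg : Differentiable ℝ g) (v : V) :
    dd v (fun x => f x * g x) = fun x => dd v f x * g x + f x * dd v g x := by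
  funext x
  have h3 : fderiv ℝ (fun x => f x * g x) x = _ := ((hf x).hasFDerivAt.mul (hg x).hasFDerivAt).fderiv
  rw [dd, h3]
  simp only [add_apply, smul_apply, smul_eq_mul, dd]
  ring

theorem dd_comm {f : V → ℂ} (hf : IsSchwartz f) (u v : V) : dd u (dd v f) = dd v (dd u f) :=
  funext fun _ => fderiv_fderiv_comm hf.contDiff _ _ _

end Directional

theorem integral_weight_conj {V : Type*} [MeasurableSpace V] {μ : Measure V} (S : V → ℝ) (f : V → ℂ) :
    ∫ x, S x * (starRingEnd ℂ) (f x) ∂μ = (starRingEnd ℂ) (∫ x, S x * f x ∂μ) := by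
  rw [← integral_conj]
  simp

section Weight

variable {V : Type*} [NormedAddCommGroup V] [NormedSpace ℝ V] [FiniteDimensional ℝ V]
  [MeasurableSpace V] [BorelSpace V] {μ : Measure V} [μ.IsAddHaarMeasure]
  {S S' : V → ℝ} {v : V}

/-- A bounded continuous weight with a bounded continuous derivative in the direction `v`. -/
structure IsWeight (S S' : V → ℝ) (v : V) : Prop where
  continuous : Continuous S
  continuous' : Continuous S'
  hasLineDerivAt : ∀ x, HasLineDerivAt ℝ S (S' x) x v
  bdd : ∃ C, ∀ x, |S x| ≤ C
  bdd' : ∃ C, ∀ x, |S' x| ≤ C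

theorem IsWeight.integral_dd_mul (h : IsWeight S S' v) {f g : V → ℂ} (hf : IsSchwartz f)
    (hg : IsSchwartz g) : ∫ x, S x * (dd v f x * g x) ∂μ =
      - (∫ x, S x * (f x * dd v g x) ∂μ) - ∫ x, S' x * (f x * g x) ∂μ := by
  obtain ⟨C, hC⟩ := h.bdd
  obtain ⟨C', hC'⟩ := h.bdd'
  refine integral_weight_mul_fderiv hf hg v (continuous_ofReal.comp h.continuous)
    (continuous_ofReal.comp h.continuous') (fun x => ?_) (C := max C C') (fun x => ?_) (fun x => ?_)
  · exact HasDerivAt.ofReal_comp (h.hasLineDerivAt x)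
  · simpa using Or.inl (hC x)
  · simpa using Or.inr (hC' x)

theorem IsWeight.integrable (h : IsWeight S S' v) {f : V → ℂ} (hf : IsSchwartz f) :
    Integrable (fun x => S x * f x) μ := by
  obtain ⟨C, hC⟩ := h.bdd
  refine hf.integrable.bdd_mul (c := C) (continuous_ofReal.comp h.continuous).aestronglyMeasurable
    (Filter.Eventually.of_forall fun x => ?_)
  simpa using hC x

/-- The weighted mean of the derivative of `|g|²`. -/
theorem IsWeight.re_integral_conj_dd_mul (h : IsWeight S S' v) {g : V → ℂ} (hg : IsSchwartz g) :
    2 * (∫ x, S x * ((starRingEnd ℂ) (dd v g x) * g x) ∂μ).re = -∫ x, S' x * ‖g x‖ ^ 2 ∂μ := by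
  have h1 := h.integral_dd_mul (μ := μ) hg.conj hg
  rw [dd_conj hg.differentiable] at h1
  have h2 : ∀ x, (S x : ℂ) * ((starRingEnd ℂ) (g x) * dd v g x) =
      S x * (starRingEnd ℂ) ((starRingEnd ℂ) (dd v g x) * g x) := fun x => by
    rw [map_mul, conj_conj]; ring
  have h3 : ∀ x, (S' x : ℂ) * ((starRingEnd ℂ) (g x) * g x) = ((S' x * ‖g x‖ ^ 2 : ℝ) : ℂ) := fun x => by
    rw [conj_mul_self_eq]; push_cast; rfl
  simp_rw [h2, h3] at h1
  rw [integral_weight_conj, integral_complex_ofReal] at h1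
  have := congrArg Complex.re h1
  simp only [sub_re, neg_re, conj_re, ofReal_re] at this
  linarith

/-- The virial identity for the flow `-i F' = (-∂_E ∂_D - ∂_a² + ∂_b² + W) F`, with a weight which
only varies in the direction `E`. -/
theorem virial_identity {d e a b : V} (hd : IsWeight S (fun _ => 0) d) (he : IsWeight S S' e)
    (ha : IsWeight S (fun _ => 0) a) (hb : IsWeight S (fun _ => 0) b) {W W' : V → ℝ}
    (hW : (fun x => (W x : ℂ)).HasTemperateGrowth) (hW' : ∀ x, dd d (fun x => (W x : ℂ)) x = W' x)
    {F G : V → ℂ} (hF : IsSchwartz F)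
    (hG : ∀ x, G x = I * (-dd e (dd d F) x - dd a (dd a F) x + dd b (dd b F) x + W x * F x)) :
    (∫ x, S x * ((starRingEnd ℂ) (G x) * dd d F x + (starRingEnd ℂ) (F x) * dd d G x) ∂μ).im =
      -(∫ x, S' x * ‖dd d F x‖ ^ 2 ∂μ) + ∫ x, S x * (W' x * ‖F x‖ ^ 2) ∂μ := by
  have hWF := hF.tmul hW
  have hdF := hF.dd d
  have hGs : IsSchwartz G := ((((hdF.dd e).neg.sub ((hF.dd a).dd a)).add
    ((hF.dd b).dd b)).add hWF).const_mul I |>.congr fun x => (hG x).symm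
  have hc := hdF.conj
  set Y := ∫ x, S x * ((starRingEnd ℂ) (dd d F x) * G x) ∂μ with hY
  have hJ : ∫ x, S x * ((starRingEnd ℂ) (G x) * dd d F x + (starRingEnd ℂ) (F x) * dd d G x) ∂μ =
      (starRingEnd ℂ) Y - Y := by
    have h1 := hd.integral_dd_mul (μ := μ) hF.conj hGs
    rw [dd_conj hF.differentiable] at h1
    simp only [ofReal_zero, zero_mul, integral_zero, sub_zero, ← hY] at h1
    rw [hY, ← integral_weight_conj, ← hY]
    simp_rw [mul_add]
    rw [integral_add (hd.integrable (hGs.conj.mul hdF)) (hd.integrable (hF.conj.mul (hGs.dd d)))]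
    have h2 : ∀ x, (S x : ℂ) * ((starRingEnd ℂ) (G x) * dd d F x) =
      S x * (starRingEnd ℂ) ((starRingEnd ℂ) (dd d F x) * G x) := fun x => by
      rw [map_mul, conj_conj]; ring
    simp_rw [h2]
    rw [h1]
    ring
  have hYZ : Y = I * (-(∫ x, S x * ((starRingEnd ℂ) (dd d F x) * dd e (dd d F) x) ∂μ)
      - (∫ x, S x * ((starRingEnd ℂ) (dd d F x) * dd a (dd a F) x) ∂μ)
      + (∫ x, S x * ((starRingEnd ℂ) (dd d F x) * dd b (dd b F) x) ∂μ)
      + ∫ x, S x * ((starRingEnd ℂ) (dd d F x) * (W x * F x)) ∂μ) := by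
    have j1 := hd.integrable (μ := μ) (hc.mul (hdF.dd e))
    have j2 := hd.integrable (μ := μ) (hc.mul ((hF.dd a).dd a))
    have j3 := hd.integrable (μ := μ) (hc.mul ((hF.dd b).dd b))
    have j4 := hd.integrable (μ := μ) (hc.mul hWF)
    rw [← integral_neg, ← integral_sub (by exact j1.neg) j2, ← integral_add (by exact j1.neg.sub j2) j3,
      ← integral_add (by exact (j1.neg.sub j2).add j3) j4, ← integral_const_mul, hY]
    refine integral_congr_ae (Filter.Eventually.of_forall fun x => ?_)
    simp only [hG]
    ring
  have hre : ∀ {v : V} {T' : V → ℝ}, IsWeight S T' v → ∀ {g : V → ℂ}, IsSchwartz g →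
      2 * (∫ x, S x * ((starRingEnd ℂ) (g x) * dd v g x) ∂μ).re = -∫ x, T' x * ‖g x‖ ^ 2 ∂μ := by
    intro v T' h g hg
    rw [← h.re_integral_conj_dd_mul hg, ← conj_re, ← integral_weight_conj]
    simp only [map_mul, conj_conj, mul_comm]
  have z1 := hre he hdF
  have z2 : ∀ {c : V}, IsWeight S (fun _ => 0) c →
      (∫ x, S x * ((starRingEnd ℂ) (dd d F x) * dd c (dd c F) x) ∂μ).re = 0 := by
    intro c h
    have h1 := h.integral_dd_mul (μ := μ) hc (hF.dd c)
    have h2 := hd.re_integral_conj_dd_mul (μ := μ) (hF.dd c)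
    rw [dd_conj hdF.differentiable, dd_comm hF] at h1
    simp only [ofReal_zero, zero_mul, integral_zero, sub_zero, neg_zero] at h1 h2
    rw [h1, neg_re] at h2
    linarith
  have z4 : 2 * (∫ x, S x * ((starRingEnd ℂ) (dd d F x) * (W x * F x)) ∂μ).re =
      -∫ x, S x * (W' x * ‖F x‖ ^ 2) ∂μ := by
    have h1 := hd.integral_dd_mul (μ := μ) hF.conj hWF
    rw [dd_conj hF.differentiable, dd_mul (hW.1.differentiable (by simp)) hF.differentiable] at h1
    simp only [ofReal_zero, zero_mul, integral_zero, sub_zero, hW'] at h1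
    have hWdF : IsSchwartz fun x => (starRingEnd ℂ) (F x) * (W x * dd d F x) :=
      hF.conj.mul (hdF.tmul hW)
    have hW'F : IsSchwartz fun x => (starRingEnd ℂ) (F x) * (W' x * F x) :=
      hF.conj.mul (((hWF.dd d).sub (hdF.tmul hW)).congr fun x => by
        rw [dd_mul (hW.1.differentiable (by simp)) hF.differentiable]
        simp only [hW']
        ring)
    simp_rw [mul_add] at h1
    rw [integral_add (hd.integrable hW'F) (hd.integrable hWdF)] at h1
    have h2 : ∀ x, (S x : ℂ) * ((starRingEnd ℂ) (F x) * (W x * dd d F x)) =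
        S x * (starRingEnd ℂ) ((starRingEnd ℂ) (dd d F x) * (W x * F x)) := fun x => by
      rw [map_mul, conj_conj, map_mul, conj_ofReal]; ring
    have h3 : ∀ x, (S x : ℂ) * ((starRingEnd ℂ) (F x) * (W' x * F x)) =
        ((S x * (W' x * ‖F x‖ ^ 2) : ℝ) : ℂ) := fun x => by
      have := conj_mul_self_eq (F x)
      push_cast at this ⊢
      linear_combination (S x * W' x : ℂ) * this
    simp_rw [h2, h3] at h1
    rw [integral_weight_conj, integral_complex_ofReal] at h1
    have := congrArg Complex.re h1
    simp only [neg_re, add_re, conj_re, ofReal_re] at this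
    linarith
  rw [hJ, sub_im, conj_im, hYZ]
  simp only [I_mul_im, add_re, sub_re, neg_re, z2 ha, z2 hb]
  linarith

end Weight

/-- The separation of two points in the first coordinate. -/
def separation : E2 × E2 →L[ℝ] ℝ :=
  (EuclideanSpace.proj (0 : Fin 2)).comp (ContinuousLinearMap.fst ℝ E2 E2) -
    (EuclideanSpace.proj (0 : Fin 2)).comp (ContinuousLinearMap.snd ℝ E2 E2)

theorem separation_apply (q : E2 × E2) : separation q = q.1 0 - q.2 0 := rfl

theorem isWeight_arctan {M : ℝ} (hM : 0 ≤ M) (v : E2 × E2) :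
    IsWeight (fun q => Real.arctan (M * separation q))
      (fun q => separation v * (M / (1 + (M * separation q) ^ 2))) v where
  continuous := Real.continuous_arctan.comp (by fun_prop)
  continuous' := by
    refine continuous_const.mul (continuous_const.div (by fun_prop) fun q => ?_)
    positivity
  hasLineDerivAt q := by
    have h1 : HasDerivAt (fun t : ℝ => M * (separation q + t * separation v)) (M * separation v) 0 := by
      simpa using (((hasDerivAt_id (0 : ℝ)).mul_const (separation v)).const_add (separation q)).const_mul M
    have h2 := h1.arctan
    simp only [zero_mul, add_zero] at h2
    have h3 : (fun t : ℝ => Real.arctan (M * separation (q + t • v))) =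
        fun t : ℝ => Real.arctan (M * (separation q + t * separation v)) := by
      funext t; rw [map_add, map_smul, smul_eq_mul]
    rw [HasLineDerivAt, h3]
    refine h2.congr_deriv ?_
    field_simp
  bdd := ⟨Real.pi / 2, fun q => abs_le.2 ⟨(Real.neg_pi_div_two_lt_arctan _).le,
    (Real.arctan_lt_pi_div_two _).le⟩⟩
  bdd' := by
    refine ⟨|separation v| * M, fun q => ?_⟩
    rw [abs_mul, abs_of_nonneg (by positivity : 0 ≤ M / (1 + (M * separation q) ^ 2))]
    gcongr
    exact div_le_self hM (by nlinarith [sq_nonneg (M * separation q)])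

section Directional

variable {V : Type*} [NormedAddCommGroup V] [NormedSpace ℝ V]

theorem dd_add {f g : V → ℂ} (hf : Differentiable ℝ f) (hg : Differentiable ℝ g) (v : V) :
    dd v (fun x => f x + g x) = fun x => dd v f x + dd v g x := by
  funext x
  have h3 : fderiv ℝ (fun x => f x + g x) x = _ := ((hf x).hasFDerivAt.add (hg x).hasFDerivAt).fderiv
  rw [dd, h3]
  rfl

theorem dd_const_mul {f : V → ℂ} (hf : Differentiable ℝ f) (c : ℂ) (v : V) :
    dd v (fun x => c * f x) = fun x => c * dd v f x := by
  rw [dd_mul (differentiable_const c) hf]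
  funext x
  simp [dd]

theorem dd_neg_vec (f : V → ℂ) (v : V) (x : V) : dd (-v) f x = -dd v f x := map_neg _ _

end Directional

theorem dd_tensor {f g : E2 → ℂ} (hf : Differentiable ℝ f) (hg : Differentiable ℝ g) (v w : E2) :
    dd (v, w) (fun q : E2 × E2 => f q.1 * g q.2) =
      fun q => dd v f q.1 * g q.2 + f q.1 * dd w g q.2 := by
  have h1 : Differentiable ℝ (fun q : E2 × E2 => f q.1) := hf.comp differentiable_fst
  have h2 : Differentiable ℝ (fun q : E2 × E2 => g q.2) := hg.comp differentiable_snd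
  rw [dd_mul h1 h2]
  funext q
  have e1 : fderiv ℝ (fun q : E2 × E2 => f q.1) q = _ :=
    ((hf q.1).hasFDerivAt.comp q hasFDerivAt_fst).fderiv
  have e2 : fderiv ℝ (fun q : E2 × E2 => g q.2) q = _ :=
    ((hg q.2).hasFDerivAt.comp q hasFDerivAt_snd).fderiv
  simp only [dd]
  rw [e1, e2]
  rfl

theorem dd_zero (f : E2 → ℂ) (x : E2) : dd 0 f x = 0 := map_zero _

theorem Aop_conj {f : E2 → ℂ} (hf : IsSchwartz f) (x : E2) :
    Aop (fun y => (starRingEnd ℂ) (f y)) x = (starRingEnd ℂ) (Aop f x) := by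
  have h : ∀ i, pd i (pd i (fun y => (starRingEnd ℂ) (f y))) x = (starRingEnd ℂ) (pd i (pd i f) x) :=
    fun i => by rw [pd_conj hf.differentiable, pd_conj (hf.pd i).differentiable]
  simp only [Aop, lap, Fin.sum_univ_two, h]
  simp

/-- The derivative of a tensor product in the direction of a common translation along the first
coordinate. -/
def transDeriv (f g : E2 → ℂ) (q : E2 × E2) : ℂ := pd 0 f q.1 * g q.2 + f q.1 * pd 0 g q.2

theorem dd_trans {f g : E2 → ℂ} (hf : IsSchwartz f) (hg : IsSchwartz g) :
    dd (EuclideanSpace.single 0 1, EuclideanSpace.single 0 1) (fun q : E2 × E2 => f q.1 * g q.2) =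
      transDeriv f g := dd_tensor hf.differentiable hg.differentiable _ _

theorem isSchwartz_transDeriv {f g : E2 → ℂ} (hf : IsSchwartz f) (hg : IsSchwartz g) :
    IsSchwartz (transDeriv f g) := ((hf.pd 0).prod_mul hg).add (hf.prod_mul (hg.pd 0))

theorem static_virial {f g : E2 → ℂ} (hf : IsSchwartz f) (hg : IsSchwartz g) {M : ℝ} (hM : 0 ≤ M) :
    (∫ q : E2 × E2, (Real.arctan (M * separation q) : ℂ) *
      ((starRingEnd ℂ) (I * (Aop f q.1 * g q.2 - f q.1 * Aop g q.2)) * transDeriv f g q +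
        (starRingEnd ℂ) (f q.1 * g q.2) *
          (I * (transDeriv (Aop f) g q - transDeriv f (Aop g) q)))).im =
      -(∫ q, 2 * (M / (1 + (M * separation q) ^ 2)) * ‖transDeriv f g q‖ ^ 2) +
        ∫ q, Real.arctan (M * separation q) * (2 * separation q * ‖f q.1 * g q.2‖ ^ 2) := by
  have : (volume : Measure (E2 × E2)).IsAddHaarMeasure := Measure.prod.instIsAddHaarMeasure _ _
  set e0 : E2 := EuclideanSpace.single 0 1 with he0
  set e1 : E2 := EuclideanSpace.single 1 1 with he1
  set G : E2 × E2 → ℂ := fun q => I * (Aop f q.1 * g q.2 - f q.1 * Aop g q.2) with hGdef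
  have hw : ∀ v, separation v = 0 → IsWeight (fun q => Real.arctan (M * separation q))
      (fun _ => 0) v := fun v hv => by
    have := isWeight_arctan hM v
    simpa only [hv, zero_mul] using this
  have hd := hw (e0, e0) (by simp [separation_apply])
  have ha := hw (e1, 0) (by simp [separation_apply, he1])
  have hb := hw (0, e1) (by simp [separation_apply, he1])
  have he := isWeight_arctan hM (e0, -e0)
  have hs : separation (e0, -e0) = 2 := by
    simp [separation_apply, he0]; norm_num
  rw [hs] at he
  set W : E2 × E2 → ℝ := fun q => ‖q.1‖ ^ 2 - ‖q.2‖ ^ 2 with hWdef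
  have hc : ∀ L : E2 × E2 →L[ℝ] ℝ, (fun q => ((L q : ℝ) : ℂ)).HasTemperateGrowth := fun L =>
    (Complex.ofRealCLM.comp L).hasTemperateGrowth
  set X : Fin 2 → E2 × E2 →L[ℝ] ℝ := fun i =>
    (EuclideanSpace.proj i : E2 →L[ℝ] ℝ).comp (ContinuousLinearMap.fst ℝ E2 E2) with hX
  set Y : Fin 2 → E2 × E2 →L[ℝ] ℝ := fun i =>
    (EuclideanSpace.proj i : E2 →L[ℝ] ℝ).comp (ContinuousLinearMap.snd ℝ E2 E2) with hY
  have hWeq : (fun q => (W q : ℂ)) = fun q => ((X 0 q : ℂ) * X 0 q + X 1 q * X 1 q) -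
      ((Y 0 q : ℂ) * Y 0 q + Y 1 q * Y 1 q) := by
    funext q
    change ((‖q.1‖ ^ 2 - ‖q.2‖ ^ 2 : ℝ) : ℂ) = ((q.1 0 : ℂ) * q.1 0 + q.1 1 * q.1 1) -
      ((q.2 0 : ℂ) * q.2 0 + q.2 1 * q.2 1)
    rw [norm_sq_E2, norm_sq_E2]
    push_cast
    ring
  have hW : (fun q => (W q : ℂ)).HasTemperateGrowth := by
    rw [hWeq]
    exact (((hc (X 0)).mul (hc (X 0))).add ((hc (X 1)).mul (hc (X 1)))).sub
      (((hc (Y 0)).mul (hc (Y 0))).add ((hc (Y 1)).mul (hc (Y 1))))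
  have hW' : ∀ q, dd (e0, e0) (fun q => (W q : ℂ)) q = ((2 * separation q : ℝ) : ℂ) := by
    intro q
    have hL : ∀ L : E2 × E2 →L[ℝ] ℝ, HasFDerivAt (fun q => ((L q : ℝ) : ℂ)) (Complex.ofRealCLM.comp L) q :=
      fun L => (Complex.ofRealCLM.comp L).hasFDerivAt
    have h1 := ((((hL (X 0)).mul (hL (X 0))).add ((hL (X 1)).mul (hL (X 1)))).sub
      (((hL (Y 0)).mul (hL (Y 0))).add ((hL (Y 1)).mul (hL (Y 1)))))
    rw [dd, (h1.congr_of_eventuallyEq (Filter.Eventually.of_forall fun q => congrFun hWeq q)).fderiv]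
    simp [hX, hY, he0, separation_apply]
    ring
  have hF := hf.prod_mul hg
  have hp : ∀ {f g : E2 → ℂ}, IsSchwartz f → IsSchwartz g → ∀ v w : E2,
    dd (v, w) (fun q : E2 × E2 => f q.1 * g q.2) =
      fun q => dd v f q.1 * g q.2 + f q.1 * dd w g q.2 := fun hf hg v w =>
    dd_tensor hf.differentiable hg.differentiable v w
  have hdF := dd_trans hf hg
  have hG : ∀ q, G q = I * (-dd (e0, -e0) (dd (e0, e0) (fun q : E2 × E2 => f q.1 * g q.2)) q
      - dd (e1, 0) (dd (e1, 0) (fun q : E2 × E2 => f q.1 * g q.2)) q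
      + dd (0, e1) (dd (0, e1) (fun q : E2 × E2 => f q.1 * g q.2)) q
      + W q * (f q.1 * g q.2)) := by
    intro q
    have q1 : dd (e1, 0) (fun q : E2 × E2 => f q.1 * g q.2) = fun q => pd 1 f q.1 * g q.2 := by
      rw [hp hf hg]; funext q; rw [dd_zero, mul_zero, add_zero]; rfl
    have q2 : dd (0, e1) (fun q : E2 × E2 => f q.1 * g q.2) = fun q => f q.1 * pd 1 g q.2 := by
      rw [hp hf hg]; funext q; rw [dd_zero, zero_mul, zero_add]; rfl
    have q3 : dd (e0, -e0) (transDeriv f g) q = pd 0 (pd 0 f) q.1 * g q.2 - f q.1 * pd 0 (pd 0 g) q.2 := by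
      unfold transDeriv
      rw [dd_add ((hf.pd 0).prod_mul hg).differentiable (hf.prod_mul (hg.pd 0)).differentiable,
        hp (hf.pd 0) hg, hp hf (hg.pd 0)]
      simp only [dd_neg_vec]
      simp only [dd, pd, ← he0]
      ring
    rw [hdF, q1, q2, q3, hp (hf.pd 1) hg, hp hf (hg.pd 1)]
    simp only [dd_zero]
    simp only [hGdef, Aop, lap, Fin.sum_univ_two, hWdef, dd]
    simp only [pd, he1]
    push_cast
    ring
  have key := virial_identity (μ := volume) hd he ha hb hW hW' hF hG
  have hdG : dd (e0, e0) G = fun q => I * (transDeriv (Aop f) g q - transDeriv f (Aop g) q) := by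
    have h0 : G = fun q => I * (Aop f q.1 * g q.2 + (-1) * (f q.1 * Aop g q.2)) := by
      funext q; simp only [hGdef]; ring
    have s1 := hf.Aop.prod_mul hg
    have s2 := hf.prod_mul hg.Aop
    rw [h0, dd_const_mul (s1.add (s2.const_mul (-1))).differentiable,
      dd_add s1.differentiable (s2.const_mul (-1)).differentiable, dd_const_mul s2.differentiable,
      dd_trans hf.Aop hg, dd_trans hf hg.Aop]
    funext q
    ring
  rw [hdF, hdG] at key
  exact key

section Tame

variable {V : Type*} [NormedAddCommGroup V] [NormedSpace ℝ V] [MeasureSpace V]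

/-- A jointly continuous family of Schwartz functions, bounded in `L²`. -/
structure IsTame (a : ℝ → V → ℂ) : Prop where
  isSchwartz : ∀ t, IsSchwartz (a t)
  continuous : Continuous (fun p : ℝ × V => a p.1 p.2)
  bdd : ∃ K, ∀ t, ∫ x, ‖a t x‖ ^ 2 ≤ K

theorem IsTame.const_mul {a : ℝ → V → ℂ} (c : ℂ) (ha : IsTame a) :
    IsTame (fun t x => c * a t x) where
  isSchwartz t := (ha.isSchwartz t).const_mul c
  continuous := continuous_const.mul ha.continuous
  bdd := by
    obtain ⟨K, hK⟩ := ha.bdd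
    refine ⟨‖c‖ ^ 2 * K, fun t => ?_⟩
    simp only [norm_mul, mul_pow, integral_const_mul]
    gcongr
    exact hK t

theorem IsTame.conj {a : ℝ → V → ℂ} (ha : IsTame a) :
    IsTame (fun t x => (starRingEnd ℂ) (a t x)) where
  isSchwartz t := (ha.isSchwartz t).conj
  continuous := continuous_conj.comp ha.continuous
  bdd := by simpa using ha.bdd

variable [FiniteDimensional ℝ V] [BorelSpace V] [(volume : Measure V).IsAddHaarMeasure]

theorem IsTame.add {a b : ℝ → V → ℂ} (ha : IsTame a) (hb : IsTame b) :
    IsTame (fun t x => a t x + b t x) where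
  isSchwartz t := (ha.isSchwartz t).add (hb.isSchwartz t)
  continuous := ha.continuous.add hb.continuous
  bdd := by
    obtain ⟨K, hK⟩ := ha.bdd
    obtain ⟨L, hL⟩ := hb.bdd
    refine ⟨2 * K + 2 * L, fun t => ?_⟩
    have h1 := ((ha.isSchwartz t).integrable_normSq (μ := volume)).const_mul 2
    have h2 := ((hb.isSchwartz t).integrable_normSq (μ := volume)).const_mul 2
    calc ∫ x, ‖a t x + b t x‖ ^ 2 ≤ ∫ x, (2 * ‖a t x‖ ^ 2 + 2 * ‖b t x‖ ^ 2) := by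
          refine integral_mono ((ha.isSchwartz t).add (hb.isSchwartz t)).integrable_normSq
            (h1.add h2) fun x => ?_
          have h3 := norm_add_le (a t x) (b t x)
          have h4 := norm_nonneg (a t x + b t x)
          simp only
          nlinarith [sq_nonneg (‖a t x‖ - ‖b t x‖)]
      _ = 2 * (∫ x, ‖a t x‖ ^ 2) + 2 * ∫ x, ‖b t x‖ ^ 2 := by
          rw [integral_add h1 h2, integral_const_mul, integral_const_mul]
      _ ≤ _ := by gcongr <;> simp_all

/-- Fubini-integrability of a weighted sesquilinear product of tame families. -/
theorem IsTame.integrable_prod {a b : ℝ → V → ℂ} (ha : IsTame a) (hb : IsTame b) {S : V → ℝ}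
    (hS : Continuous S) {C : ℝ} (hC : ∀ x, |S x| ≤ C) (T : ℝ) :
    Integrable (fun p : ℝ × V => (S p.2 : ℂ) * ((starRingEnd ℂ) (a p.1 p.2) * b p.1 p.2))
      ((volume.restrict (Set.Ioc 0 T)).prod volume) := by
  have hcont : Continuous (fun p : ℝ × V => (S p.2 : ℂ) * ((starRingEnd ℂ) (a p.1 p.2) * b p.1 p.2)) :=
    (continuous_ofReal.comp (hS.comp continuous_snd)).mul
      ((continuous_conj.comp ha.continuous).mul hb.continuous)
  have hs : ∀ t, Integrable (fun x => (S x : ℂ) * ((starRingEnd ℂ) (a t x) * b t x)) := fun t => by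
    refine ((ha.isSchwartz t).conj.mul (hb.isSchwartz t)).integrable.bdd_mul (c := C)
      (continuous_ofReal.comp hS).aestronglyMeasurable (Filter.Eventually.of_forall fun x => ?_)
    simpa using hC x
  have hC0 : 0 ≤ C := (abs_nonneg _).trans (hC 0)
  obtain ⟨K, hK⟩ := ha.bdd
  obtain ⟨L, hL⟩ := hb.bdd
  refine (integrable_prod_iff hcont.aestronglyMeasurable).2
    ⟨Filter.Eventually.of_forall hs, Integrable.of_bound (C := C * (K + L))
      hcont.aestronglyMeasurable.norm.integral_prod_right' (Filter.Eventually.of_forall fun t => ?_)⟩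
  have h1 := (ha.isSchwartz t).integrable_normSq (μ := volume)
  have h2 := (hb.isSchwartz t).integrable_normSq (μ := volume)
  rw [Real.norm_of_nonneg (by positivity)]
  calc ∫ x, ‖(S x : ℂ) * ((starRingEnd ℂ) (a t x) * b t x)‖
      ≤ ∫ x, C * (‖a t x‖ ^ 2 + ‖b t x‖ ^ 2) := by
        refine integral_mono (hs t).norm ((h1.add h2).const_mul C) fun x => ?_
        simp only [norm_mul, RCLike.norm_conj, norm_real, Real.norm_eq_abs]
        have := hC x
        have h0 : ‖a t x‖ * ‖b t x‖ ≤ ‖a t x‖ ^ 2 + ‖b t x‖ ^ 2 := by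
          nlinarith [sq_nonneg (‖a t x‖ - ‖b t x‖), sq_nonneg ‖a t x‖, sq_nonneg ‖b t x‖]
        gcongr
    _ = C * ((∫ x, ‖a t x‖ ^ 2) + ∫ x, ‖b t x‖ ^ 2) := by
        rw [integral_const_mul, integral_add h1 h2]
    _ ≤ _ := by gcongr <;> simp_all

end Tame

/-- The fundamental theorem of calculus under a weighted integral. -/
theorem integral_weight_deriv {V : Type*} [TopologicalSpace V] [MeasureSpace V]
    [SFinite (volume : Measure V)] {S : V → ℝ} {a n : ℝ → V → ℂ} {T : ℝ} (hT : 0 ≤ T)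
    (h : ∀ t x, HasDerivAt (fun s => a s x) (n t x) t)
    (hn : Continuous (fun p : ℝ × V => n p.1 p.2))
    (hSn : Integrable (fun p : ℝ × V => (S p.2 : ℂ) * n p.1 p.2)
      ((volume.restrict (Set.Ioc 0 T)).prod volume))
    (ha : ∀ t, Integrable (fun x => (S x : ℂ) * a t x)) :
    ∫ t in (0 : ℝ)..T, ∫ x, (S x : ℂ) * n t x =
      (∫ x, (S x : ℂ) * a T x) - ∫ x, (S x : ℂ) * a 0 x := by
  rw [intervalIntegral.integral_of_le hT, integral_integral_swap hSn,
    ← integral_sub (ha T) (ha 0)]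
  refine integral_congr_ae (Filter.Eventually.of_forall fun x => ?_)
  have hc : Continuous fun t => n t x := hn.comp (by fun_prop : Continuous fun t : ℝ => (t, x))
  simp only
  rw [← intervalIntegral.integral_of_le hT, intervalIntegral.integral_const_mul,
    intervalIntegral.integral_eq_sub_of_hasDerivAt (fun t _ => h t x) (hc.intervalIntegrable _ _)]
  ring

instance : (volume : Measure (E2 × E2)).IsAddHaarMeasure :=
  Measure.prod.instIsAddHaarMeasure _ _

theorem IsTame.tensor {a b : ℝ → E2 → ℂ} (ha : IsTame a) (hb : IsTame b) :
    IsTame (fun t (q : E2 × E2) => a t q.1 * b t q.2) where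
  isSchwartz t := (ha.isSchwartz t).prod_mul (hb.isSchwartz t)
  continuous := (ha.continuous.comp (by fun_prop : Continuous fun p : ℝ × E2 × E2 => (p.1, p.2.1))).mul
    (hb.continuous.comp (by fun_prop : Continuous fun p : ℝ × E2 × E2 => (p.1, p.2.2)))
  bdd := by
    obtain ⟨K, hK⟩ := ha.bdd
    obtain ⟨L, hL⟩ := hb.bdd
    refine ⟨K * L, fun t => ?_⟩
    simp only [norm_mul, mul_pow]
    rw [Measure.volume_eq_prod, integral_prod_mul (fun x => ‖a t x‖ ^ 2) (fun x => ‖b t x‖ ^ 2)]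
    have h0 : 0 ≤ ∫ x, ‖a t x‖ ^ 2 := by positivity
    gcongr
    · exact h0.trans (hK t)
    · exact hK t
    · exact hL t

theorem IsSchwartz.integrable_gradSq {f : E2 → ℂ} (hf : IsSchwartz f) : Integrable (gradSq f) := by
  unfold gradSq
  exact integrable_finsetSum _ fun i _ => (hf.pd i).integrable_normSq

theorem integral_norm_sq_pd_le {f : E2 → ℂ} (hf : IsSchwartz f) (i : Fin 2) :
    ∫ x, ‖pd i f x‖ ^ 2 ≤ energy f := by
  have h1 : ∫ x, ‖pd i f x‖ ^ 2 ≤ ∫ x, gradSq f x :=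
    integral_mono (hf.pd i).integrable_normSq hf.integrable_gradSq fun x =>
      Finset.single_le_sum (f := fun i => ‖pd i f x‖ ^ 2) (fun _ _ => by positivity)
        (Finset.mem_univ i)
  have h2 : 0 ≤ ∫ x : E2, ‖x‖ ^ 2 * ‖f x‖ ^ 2 := by positivity
  rw [energy]
  linarith

theorem IsSchwartz.coord_mul {f : E2 → ℂ} (hf : IsSchwartz f) (i : Fin 2) :
    IsSchwartz (fun x : E2 => (x i : ℂ) * f x) := hf.tmul (hasTemperateGrowth_coord i)

theorem integral_norm_sq_coord_mul_le {f : E2 → ℂ} (hf : IsSchwartz f) (i : Fin 2) :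
    ∫ x : E2, ‖(x i : ℂ) * f x‖ ^ 2 ≤ energy f := by
  have h1 : ∫ x : E2, ‖(x i : ℂ) * f x‖ ^ 2 ≤ ∫ x : E2, ‖x‖ ^ 2 * ‖f x‖ ^ 2 := by
    refine integral_mono (hf.coord_mul i).integrable_normSq (integrable_norm_sq_mul_norm_sq hf) fun x => ?_
    simp only [norm_mul, mul_pow, norm_real, Real.norm_eq_abs]
    have := abs_coord_le x i
    gcongr
  have h2 : 0 ≤ ∫ x, gradSq f x := integral_nonneg fun x => by
    exact Finset.sum_nonneg fun _ _ => by positivity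
  rw [energy]
  linarith

theorem integral_norm_mul_norm_le {f g : E2 → ℂ} (hf : IsSchwartz f) (hg : IsSchwartz g) :
    ∫ x, ‖f x‖ * ‖g x‖ ≤ √(∫ x, ‖f x‖ ^ 2) * √(∫ x, ‖g x‖ ^ 2) := by
  have h2 : ENNReal.ofReal 2 = 2 := by norm_num
  have hm : ∀ {f : E2 → ℂ}, IsSchwartz f → MemLp f (ENNReal.ofReal 2) volume := fun hf => by
    rw [h2]
    exact (memLp_two_iff_integrable_sq_norm hf.continuous.aestronglyMeasurable).2 hf.integrable_normSq
  have := integral_mul_norm_le_Lp_mul_Lq Real.HolderConjugate.two_two (hm hf) (hm hg)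
  simpa [Real.sqrt_eq_rpow] using this

theorem integral_norm_mul_pd_le {f : E2 → ℂ} (hf : IsSchwartz f) (i : Fin 2) :
    ∫ x, ‖f x‖ * ‖pd i f x‖ ≤ L2norm f * H1norm f := by
  refine (integral_norm_mul_norm_le hf (hf.pd i)).trans ?_
  rw [L2norm, H1norm]
  gcongr
  exact integral_norm_sq_pd_le hf i

theorem integral_abs_coord_mul_le {f : E2 → ℂ} (hf : IsSchwartz f) (i : Fin 2) :
    ∫ x : E2, |x i| * ‖f x‖ ^ 2 ≤ L2norm f * H1norm f := by
  have h : (fun x : E2 => |x i| * ‖f x‖ ^ 2) = fun x => ‖f x‖ * ‖(x i : ℂ) * f x‖ := by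
    funext x
    rw [norm_mul, norm_real, Real.norm_eq_abs]
    ring
  rw [h]
  refine (integral_norm_mul_norm_le hf (hf.coord_mul i)).trans ?_
  rw [L2norm, H1norm]
  gcongr
  exact integral_norm_sq_coord_mul_le hf i

theorem L2norm_sq (f : E2 → ℂ) : L2norm f ^ 2 = ∫ x, ‖f x‖ ^ 2 :=
  Real.sq_sqrt (by positivity)

/-- The right-hand side of the bilinear estimate. -/
def virialBound (f g : E2 → ℂ) : ℝ :=
  L2norm g ^ 2 * L2norm f * H1norm f + L2norm f ^ 2 * L2norm g * H1norm g

theorem integral_le_virialBound {f g : E2 → ℂ} (hf : IsSchwartz f) (hg : IsSchwartz g)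
    {α β : E2 → ℝ} (hα : Integrable α) (hβ : Integrable β)
    (hα' : ∫ x, α x ≤ L2norm f * H1norm f) (hβ' : ∫ x, β x ≤ L2norm g * H1norm g)
    {h : E2 × E2 → ℝ} (h0 : ∀ q, 0 ≤ h q)
    (hh : ∀ q, h q ≤ α q.1 * ‖g q.2‖ ^ 2 + ‖f q.1‖ ^ 2 * β q.2) :
    ∫ q, h q ≤ virialBound f g := by
  have h1 : Integrable (fun q : E2 × E2 => α q.1 * ‖g q.2‖ ^ 2) :=
    hα.mul_prod hg.integrable_normSq
  have h2 : Integrable (fun q : E2 × E2 => ‖f q.1‖ ^ 2 * β q.2) :=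
    (hf.integrable_normSq (μ := volume)).mul_prod hβ
  calc ∫ q, h q ≤ ∫ q : E2 × E2, (α q.1 * ‖g q.2‖ ^ 2 + ‖f q.1‖ ^ 2 * β q.2) :=
        integral_mono_of_nonneg (Filter.Eventually.of_forall h0) (h1.add h2)
          (Filter.Eventually.of_forall hh)
    _ = (∫ x, α x) * L2norm g ^ 2 + L2norm f ^ 2 * ∫ x, β x := by
        rw [integral_add h1 h2, Measure.volume_eq_prod,
          integral_prod_mul α (fun x => ‖g x‖ ^ 2), integral_prod_mul (fun x => ‖f x‖ ^ 2) β,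
          L2norm_sq, L2norm_sq]
    _ ≤ (L2norm f * H1norm f) * L2norm g ^ 2 + L2norm f ^ 2 * (L2norm g * H1norm g) := by gcongr
    _ = _ := by rw [virialBound]; ring

theorem integral_norm_mul_transDeriv_le {f g : E2 → ℂ} (hf : IsSchwartz f) (hg : IsSchwartz g) :
    ∫ q : E2 × E2, ‖f q.1 * g q.2‖ * ‖transDeriv f g q‖ ≤ virialBound f g := by
  have hi : ∀ {f : E2 → ℂ}, IsSchwartz f → Integrable fun x => ‖f x‖ * ‖pd 0 f x‖ := fun hf => by
    simpa using (hf.mul (hf.pd 0)).integrable (μ := volume) |>.norm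
  refine integral_le_virialBound hf hg (hi hf) (hi hg) (integral_norm_mul_pd_le hf 0)
    (integral_norm_mul_pd_le hg 0) (fun q => by positivity) fun q => ?_
  have h := norm_add_le (pd 0 f q.1 * g q.2) (f q.1 * pd 0 g q.2)
  have h' := mul_le_mul_of_nonneg_left h (norm_nonneg (f q.1 * g q.2))
  refine h'.trans (le_of_eq ?_)
  simp only [norm_mul]
  ring

theorem integral_separation_le {f g : E2 → ℂ} (hf : IsSchwartz f) (hg : IsSchwartz g) :
    ∫ q : E2 × E2, |separation q| * ‖f q.1 * g q.2‖ ^ 2 ≤ virialBound f g := by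
  have hi : ∀ {f : E2 → ℂ}, IsSchwartz f → Integrable fun x : E2 => |x 0| * ‖f x‖ ^ 2 := fun hf => by
    refine (((hf.coord_mul 0).mul hf).integrable (μ := volume)).norm.congr (Filter.Eventually.of_forall fun x => ?_)
    simp only [norm_mul, norm_real, Real.norm_eq_abs]
    ring
  refine integral_le_virialBound hf hg (hi hf) (hi hg) (integral_abs_coord_mul_le hf 0)
    (integral_abs_coord_mul_le hg 0) (fun q => by positivity) fun q => ?_
  have h : |separation q| ≤ |q.1 0| + |q.2 0| := abs_sub _ _
  have h' := mul_le_mul_of_nonneg_right h (sq_nonneg ‖f q.1 * g q.2‖)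
  refine h'.trans (le_of_eq ?_)
  simp only [norm_mul]
  ring

theorem schwartzAop_coe (f : SchwartzMap E2 ℂ) : (fun y => schwartzAop f y) = Aop (fun y => f y) :=
  funext (schwartzAop_apply f)

section Solutions

variable {w : ℝ → SchwartzMap E2 ℂ}

theorem IsLinSolution.isTame (hw : IsLinSolution w) : IsTame (fun t x => w t x) where
  isSchwartz t := (w t).isSchwartz
  continuous := hw.1.continuous
  bdd := ⟨_, fun t => (hw.mass_eq t 0).le⟩

theorem IsLinSolution.isTame_pd (hw : IsLinSolution w) (i : Fin 2) :
    IsTame (fun t => pd i (fun y => w t y)) where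
  isSchwartz t := (w t).isSchwartz.pd i
  continuous := (contDiff_pd_slice hw.1 i).continuous
  bdd := ⟨_, fun t => (integral_norm_sq_pd_le (w t).isSchwartz i).trans (hw.energy_eq t 0).le⟩

theorem IsLinSolution.isTame_Aop (hw : IsLinSolution w) :
    IsTame (fun t => Aop (fun y => w t y)) := by
  simpa only [schwartzAop_apply] using hw.schwartzAop.isTame

theorem IsLinSolution.isTame_pd_Aop (hw : IsLinSolution w) (i : Fin 2) :
    IsTame (fun t => pd i (Aop (fun y => w t y))) := by
  simpa only [schwartzAop_coe] using hw.schwartzAop.isTame_pd i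

theorem IsLinSolution.hasDerivAt_pd (hw : IsLinSolution w) (i : Fin 2) (t : ℝ) (x : E2) :
    HasDerivAt (fun s => pd i (fun y => w s y) x) (I * pd i (Aop (fun y => w t y)) x) t := by
  refine (hasDerivAt_pd_slice hw.1 i t x).congr_deriv ?_
  have h : (fun y => deriv (fun s => w s y) t) = fun y => I * Aop (fun y => w t y) y :=
    funext fun y => (hw.hasDerivAt t y).deriv
  simp only [h]
  rw [pd_const_mul (w t).isSchwartz.Aop.differentiable]

theorem HasDerivAt.conj {a : ℝ → ℂ} {a' : ℂ} {t : ℝ} (h : HasDerivAt a a' t) :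
    HasDerivAt (fun s => (starRingEnd ℂ) (a s)) ((starRingEnd ℂ) a') t :=
  conjCLE.toContinuousLinearMap.hasFDerivAt.comp_hasDerivAt t h

end Solutions

theorem L2norm_conj (f : E2 → ℂ) : L2norm (fun x => (starRingEnd ℂ) (f x)) = L2norm f := by
  simp [L2norm]

theorem H1norm_conj {f : E2 → ℂ} (hf : IsSchwartz f) :
    H1norm (fun x => (starRingEnd ℂ) (f x)) = H1norm f := by
  simp [H1norm, gradSq, pd_conj hf.differentiable]

theorem IsLinSolution.L2norm_eq {w : ℝ → SchwartzMap E2 ℂ} (hw : IsLinSolution w) (s t : ℝ) :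
    L2norm (fun x => w s x) = L2norm (fun x => w t x) := by
  rw [L2norm, L2norm, hw.mass_eq s t]

theorem IsLinSolution.H1norm_eq {w : ℝ → SchwartzMap E2 ℂ} (hw : IsLinSolution w) (s t : ℝ) :
    H1norm (fun x => w s x) = H1norm (fun x => w t x) := congrArg Real.sqrt (hw.energy_eq s t)

theorem abs_arctan_le (x : ℝ) : |Real.arctan x| ≤ Real.pi / 2 :=
  abs_le.2 ⟨(Real.neg_pi_div_two_lt_arctan x).le, (Real.arctan_lt_pi_div_two x).le⟩

theorem norm_integral_weight_le {f g : E2 → ℂ} (hf : IsSchwartz f) (hg : IsSchwartz g) (M : ℝ) :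
    ‖∫ q : E2 × E2, (Real.arctan (M * separation q) : ℂ) *
      ((starRingEnd ℂ) (f q.1 * g q.2) * transDeriv f g q)‖ ≤ Real.pi / 2 * virialBound f g := by
  have hi : Integrable fun q : E2 × E2 => ‖f q.1 * g q.2‖ * ‖transDeriv f g q‖ := by
    simpa only [norm_mul] using
      ((hf.prod_mul hg).mul (isSchwartz_transDeriv hf hg)).integrable (μ := volume) |>.norm
  refine (norm_integral_le_of_norm_le (hi.const_mul (Real.pi / 2))
    (Filter.Eventually.of_forall fun q => ?_)).trans ?_
  · rw [norm_mul, norm_mul, RCLike.norm_conj, norm_real, Real.norm_eq_abs]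
    have := abs_arctan_le (M * separation q)
    gcongr
  · rw [integral_const_mul]
    have := integral_norm_mul_transDeriv_le hf hg
    gcongr

theorem integral_arctan_separation_le {f g : E2 → ℂ} (hf : IsSchwartz f) (hg : IsSchwartz g) (M : ℝ) :
    ∫ q, Real.arctan (M * separation q) * (2 * separation q * ‖f q.1 * g q.2‖ ^ 2) ≤
      Real.pi * virialBound f g := by
  have hi : Integrable fun q : E2 × E2 => |separation q| * ‖f q.1 * g q.2‖ ^ 2 := by
    have hF := hf.prod_mul hg
    have hs : (fun q : E2 × E2 => ((separation q : ℝ) : ℂ)).HasTemperateGrowth :=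
      (Complex.ofRealCLM.comp separation).hasTemperateGrowth
    refine (((hF.tmul hs).mul hF).integrable (μ := volume)).norm.congr
      (Filter.Eventually.of_forall fun x => ?_)
    simp only [norm_mul, norm_real, Real.norm_eq_abs]
    ring
  refine (Real.le_norm_self _).trans ((norm_integral_le_of_norm_le (hi.const_mul Real.pi)
    (Filter.Eventually.of_forall fun q => ?_)).trans ?_)
  · rw [Real.norm_eq_abs, abs_mul, abs_mul, abs_mul, abs_of_nonneg (sq_nonneg ‖f q.1 * g q.2‖), abs_two]
    have := abs_arctan_le (M * separation q)
    calc _ ≤ Real.pi / 2 * (2 * |separation q| * ‖f q.1 * g q.2‖ ^ 2) := by gcongr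
      _ = _ := by ring
  · rw [integral_const_mul]
    have := integral_separation_le hf hg
    gcongr

theorem setIntegral_transDeriv_le {f g : E2 → ℂ} (hf : IsSchwartz f) (hg : IsSchwartz g) {M : ℝ}
    (hM : 0 < M) :
    ∫ q in {q : E2 × E2 | |q.1 0 - q.2 0| < 1 / M}, M * ‖transDeriv f g q‖ ^ 2 ≤
      ∫ q, 2 * (M / (1 + (M * separation q) ^ 2)) * ‖transDeriv f g q‖ ^ 2 := by
  have hi := (isSchwartz_transDeriv hf hg).integrable_normSq (μ := volume)
  have hc : Continuous fun q => 2 * (M / (1 + (M * separation q) ^ 2)) :=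
    continuous_const.mul (continuous_const.div (by fun_prop) fun q => by positivity)
  have hi' : Integrable fun q => 2 * (M / (1 + (M * separation q) ^ 2)) * ‖transDeriv f g q‖ ^ 2 := by
    refine hi.bdd_mul (c := 2 * M) hc.aestronglyMeasurable (Filter.Eventually.of_forall fun q => ?_)
    rw [Real.norm_of_nonneg (by positivity)]
    gcongr
    exact div_le_self hM.le (by nlinarith [sq_nonneg (M * separation q)])
  have hm : MeasurableSet {q : E2 × E2 | |q.1 0 - q.2 0| < 1 / M} :=
    (isOpen_lt (continuous_abs.comp separation.continuous) continuous_const).measurableSet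
  refine (setIntegral_mono_on (hi.const_mul M).integrableOn hi'.integrableOn hm fun q hq => ?_).trans
    (setIntegral_le_integral hi' (Filter.Eventually.of_forall fun q => by positivity))
  have h1 : |separation q| < 1 / M := hq
  have h2 : (M * separation q) ^ 2 ≤ 1 := by
    rw [sq_le_one_iff_abs_le_one, abs_mul, abs_of_pos hM]
    rw [lt_div_iff₀ hM] at h1
    linarith
  gcongr
  rw [mul_div_assoc', le_div_iff₀ (by positivity)]
  nlinarith

section Flow

variable {u v : ℝ → SchwartzMap E2 ℂ}

/-- The first component of a pair of solutions, as a family of functions. -/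
def leftWave (u : ℝ → SchwartzMap E2 ℂ) (t : ℝ) (x : E2) : ℂ := u t x

/-- The conjugated second component of a pair of solutions. -/
def rightWave (v : ℝ → SchwartzMap E2 ℂ) (t : ℝ) (x : E2) : ℂ := (starRingEnd ℂ) (v t x)

/-- The generator of the flow of `leftWave u t ⊗ rightWave v t`. -/
def pairGen (u v : ℝ → SchwartzMap E2 ℂ) (t : ℝ) (q : E2 × E2) : ℂ :=
  I * (Aop (leftWave u t) q.1 * rightWave v t q.2 - leftWave u t q.1 * Aop (rightWave v t) q.2)

/-- The translation derivative of `pairGen`. -/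
def pairGenDeriv (u v : ℝ → SchwartzMap E2 ℂ) (t : ℝ) (q : E2 × E2) : ℂ :=
  I * (transDeriv (Aop (leftWave u t)) (rightWave v t) q -
    transDeriv (leftWave u t) (Aop (rightWave v t)) q)

theorem pd_rightWave (v : ℝ → SchwartzMap E2 ℂ) (t : ℝ) (i : Fin 2) :
    pd i (rightWave v t) = fun x => (starRingEnd ℂ) (pd i (fun y => v t y) x) :=
  pd_conj (v t).isSchwartz.differentiable i

theorem Aop_rightWave (v : ℝ → SchwartzMap E2 ℂ) (t : ℝ) :
    Aop (rightWave v t) = fun x => (starRingEnd ℂ) (Aop (fun y => v t y) x) :=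
  funext fun x => Aop_conj (v t).isSchwartz x

theorem pd_Aop_rightWave (v : ℝ → SchwartzMap E2 ℂ) (t : ℝ) (i : Fin 2) :
    pd i (Aop (rightWave v t)) = fun x => (starRingEnd ℂ) (pd i (Aop (fun y => v t y)) x) := by
  rw [Aop_rightWave, pd_conj (v t).isSchwartz.Aop.differentiable]

theorem isSchwartz_rightWave (v : ℝ → SchwartzMap E2 ℂ) (t : ℝ) : IsSchwartz (rightWave v t) :=
  (v t).isSchwartz.conj

theorem isTame_pair (hu : IsLinSolution u) (hv : IsLinSolution v) :
    IsTame (fun t (q : E2 × E2) => leftWave u t q.1 * rightWave v t q.2) :=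
  hu.isTame.tensor hv.isTame.conj

theorem isTame_transDeriv (hu : IsLinSolution u) (hv : IsLinSolution v) :
    IsTame (fun t => transDeriv (leftWave u t) (rightWave v t)) := by
  unfold transDeriv
  simp only [pd_rightWave]
  exact ((hu.isTame_pd 0).tensor hv.isTame.conj).add (hu.isTame.tensor (hv.isTame_pd 0).conj)

theorem isTame_pairGen (hu : IsLinSolution u) (hv : IsLinSolution v) : IsTame (pairGen u v) := by
  have h : pairGen u v = fun t q => I * (Aop (leftWave u t) q.1 * rightWave v t q.2 +
      (-1) * (leftWave u t q.1 * (starRingEnd ℂ) (Aop (fun y => v t y) q.2))) := by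
    funext t q
    rw [pairGen, Aop_rightWave]
    ring
  rw [h]
  exact ((hu.isTame_Aop.tensor hv.isTame.conj).add
    ((hu.isTame.tensor hv.isTame_Aop.conj).const_mul (-1))).const_mul I

theorem isTame_pairGenDeriv (hu : IsLinSolution u) (hv : IsLinSolution v) :
    IsTame (pairGenDeriv u v) := by
  have h : pairGenDeriv u v = fun t q =>
      I * ((pd 0 (Aop (leftWave u t)) q.1 * rightWave v t q.2 +
        Aop (leftWave u t) q.1 * (starRingEnd ℂ) (pd 0 (fun y => v t y) q.2)) +
      (-1) * (pd 0 (leftWave u t) q.1 * (starRingEnd ℂ) (Aop (fun y => v t y) q.2) +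
        leftWave u t q.1 * (starRingEnd ℂ) (pd 0 (Aop (fun y => v t y)) q.2))) := by
    funext t q
    rw [pairGenDeriv, transDeriv, transDeriv, pd_rightWave, pd_Aop_rightWave, Aop_rightWave]
    ring
  rw [h]
  exact ((((hu.isTame_pd_Aop 0).tensor hv.isTame.conj).add
    (hu.isTame_Aop.tensor (hv.isTame_pd 0).conj)).add
    ((((hu.isTame_pd 0).tensor hv.isTame_Aop.conj).add
      (hu.isTame.tensor (hv.isTame_pd_Aop 0).conj)).const_mul (-1))).const_mul I

theorem hasDerivAt_pair (hu : IsLinSolution u) (hv : IsLinSolution v) (t : ℝ) (q : E2 × E2) :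
    HasDerivAt (fun s => leftWave u s q.1 * rightWave v s q.2) (pairGen u v t q) t := by
  refine ((hu.hasDerivAt t q.1).fun_mul (hv.hasDerivAt t q.2).conj).congr_deriv ?_
  rw [pairGen, Aop_rightWave, map_mul, conj_I]
  rw [show leftWave u t = fun y => u t y from rfl, rightWave]
  ring

theorem hasDerivAt_transDeriv (hu : IsLinSolution u) (hv : IsLinSolution v) (t : ℝ) (q : E2 × E2) :
    HasDerivAt (fun s => transDeriv (leftWave u s) (rightWave v s) q) (pairGenDeriv u v t q) t := by
  unfold transDeriv
  simp only [pd_rightWave]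
  refine (((hu.hasDerivAt_pd 0 t q.1).fun_mul (hv.hasDerivAt t q.2).conj).fun_add
    ((hu.hasDerivAt t q.1).fun_mul (hv.hasDerivAt_pd 0 t q.2).conj)).congr_deriv ?_
  rw [pairGenDeriv, transDeriv, transDeriv, pd_rightWave, pd_Aop_rightWave, Aop_rightWave, map_mul,
    map_mul, conj_I]
  rw [show leftWave u t = fun y => u t y from rfl, rightWave]
  ring

theorem virialBound_eq (hu : IsLinSolution u) (hv : IsLinSolution v) (t : ℝ) :
    virialBound (leftWave u t) (rightWave v t) =
      virialBound (leftWave u 0) (rightWave v 0) := by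
  have h1 : ∀ s, L2norm (leftWave u s) = L2norm (leftWave u 0) := fun s => hu.L2norm_eq s 0
  have h2 : ∀ s, L2norm (rightWave v s) = L2norm (fun x => v 0 x) := fun s =>
    (L2norm_conj _).trans (hv.L2norm_eq s 0)
  have h3 : ∀ s, H1norm (leftWave u s) = H1norm (leftWave u 0) := fun s => hu.H1norm_eq s 0
  have h4 : ∀ s, H1norm (rightWave v s) = H1norm (fun x => v 0 x) := fun s =>
    (H1norm_conj (v s).isSchwartz).trans (hv.H1norm_eq s 0)
  rw [virialBound, virialBound, h1, h2 t, h3, h4 t, h2 0, h4 0]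

/-- The time-integrated virial estimate for a pair of solutions. -/
theorem integral_transDeriv_le (hu : IsLinSolution u) (hv : IsLinSolution v) {T M : ℝ} (hT : 0 ≤ T)
    (hM : 0 < M) :
    ∫ t in (0 : ℝ)..T, ∫ q in {q : E2 × E2 | |q.1 0 - q.2 0| < 1 / M},
        M * ‖transDeriv (leftWave u t) (rightWave v t) q‖ ^ 2 ≤
      Real.pi * (1 + T) * virialBound (leftWave u 0) (rightWave v 0) := by
  set R := virialBound (leftWave u 0) (rightWave v 0) with hR
  set S : E2 × E2 → ℝ := fun q => Real.arctan (M * separation q) with hSdef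
  set n : ℝ → E2 × E2 → ℂ := fun t q =>
    (starRingEnd ℂ) (pairGen u v t q) * transDeriv (leftWave u t) (rightWave v t) q +
      (starRingEnd ℂ) (leftWave u t q.1 * rightWave v t q.2) * pairGenDeriv u v t q with hn
  have hS : Continuous S := Real.continuous_arctan.comp (by fun_prop)
  have hSb : ∀ q, |S q| ≤ Real.pi / 2 := fun q => abs_arctan_le _
  have t1 := isTame_pair hu hv
  have t2 := isTame_transDeriv hu hv
  have t3 := isTame_pairGen hu hv
  have t4 := isTame_pairGenDeriv hu hv
  have hnint : Integrable (fun p : ℝ × E2 × E2 => (S p.2 : ℂ) * n p.1 p.2)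
      ((volume.restrict (Set.Ioc 0 T)).prod volume) :=
    ((t3.integrable_prod t2 hS hSb T).add (t1.integrable_prod t4 hS hSb T)).congr
      (Filter.Eventually.of_forall fun p => (mul_add _ _ _).symm)
  have hftc := integral_weight_deriv (S := S) (n := n) hT
    (fun t q => (hasDerivAt_pair hu hv t q).conj.fun_mul (hasDerivAt_transDeriv hu hv t q))
    (((continuous_conj.comp t3.continuous).mul t2.continuous).add
      ((continuous_conj.comp t1.continuous).mul t4.continuous)) hnint
    (fun t => (isWeight_arctan hM.le 0).integrable
      ((t1.isSchwartz t).conj.mul (t2.isSchwartz t)))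
  have hb : ∀ t, ‖∫ q, (S q : ℂ) * ((starRingEnd ℂ) (leftWave u t q.1 * rightWave v t q.2) *
      transDeriv (leftWave u t) (rightWave v t) q)‖ ≤ Real.pi / 2 * R := fun t => by
    rw [hR, ← virialBound_eq hu hv t]
    exact norm_integral_weight_le (u t).isSchwartz (isSchwartz_rightWave v t) M
  have hJ : Integrable (fun t => ∫ q, (S q : ℂ) * n t q) (volume.restrict (Set.Ioc 0 T)) :=
    hnint.integral_prod_left
  have hJim : Integrable (fun t => (∫ q, (S q : ℂ) * n t q).im) (volume.restrict (Set.Ioc 0 T)) :=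
    hJ.im
  have hpt : ∀ t, ∫ q in {q : E2 × E2 | |q.1 0 - q.2 0| < 1 / M},
      M * ‖transDeriv (leftWave u t) (rightWave v t) q‖ ^ 2 ≤
        -(∫ q, (S q : ℂ) * n t q).im + Real.pi * R := fun t => by
    have hf : IsSchwartz (leftWave u t) := (u t).isSchwartz
    have hg := isSchwartz_rightWave v t
    have h1 := setIntegral_transDeriv_le hf hg hM
    have h2 := static_virial hf hg hM.le
    have h3 := integral_arctan_separation_le hf hg M
    rw [virialBound_eq hu hv t] at h3
    change (∫ q, (S q : ℂ) * n t q).im = _ at h2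
    linarith
  have htot : |∫ t in Set.Ioc 0 T, (∫ q, (S q : ℂ) * n t q).im| ≤ Real.pi * R := by
    have h1 : ∫ t in Set.Ioc 0 T, (∫ q, (S q : ℂ) * n t q).im =
        (∫ t in Set.Ioc 0 T, ∫ q, (S q : ℂ) * n t q).im := integral_im hJ
    rw [h1, ← intervalIntegral.integral_of_le hT, hftc]
    refine (abs_im_le_norm _).trans ((norm_sub_le _ _).trans ?_)
    have := hb T
    have := hb 0
    linarith
  rw [intervalIntegral.integral_of_le hT]
  calc _ ≤ ∫ t in Set.Ioc 0 T, (-(∫ q, (S q : ℂ) * n t q).im + Real.pi * R) :=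
        integral_mono_of_nonneg
          (Filter.Eventually.of_forall fun t => integral_nonneg fun q => by positivity)
          (hJim.neg.add (integrable_const _)) (Filter.Eventually.of_forall hpt)
    _ = -(∫ t in Set.Ioc 0 T, (∫ q, (S q : ℂ) * n t q).im) + T * (Real.pi * R) := by
        have hneg : Integrable (fun t => -(∫ q, (S q : ℂ) * n t q).im)
          (volume.restrict (Set.Ioc 0 T)) := hJim.neg
        rw [integral_add hneg (integrable_const _), integral_neg, setIntegral_const]
        simp [Measure.real, hT]
    _ ≤ _ := by
        have := (abs_le.1 htot).1
        linarith

end Flow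

/-- The one-dimensional localized bilinear virial estimate:
`∫₀ᵀ ∫∫_{|x₁−y₁|<1/M} M |conj(v) ∂_{x₁}u + u ∂_{y₁}conj(v)|² dxdydt
  ≤ C_T (‖v(0)‖²_{L²}‖u(0)‖_{L²}‖u(0)‖_{ℋ¹} + ‖u(0)‖²_{L²}‖v(0)‖_{L²}‖v(0)‖_{ℋ¹})`. -/
theorem bilinear_virial_1d (T : ℝ) (hT : 0 < T) :
    ∃ C : ℝ, 0 < C ∧ ∀ M : ℝ, 1 ≤ M →
      ∀ u v : ℝ → SchwartzMap E2 ℂ, IsLinSolution u → IsLinSolution v →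
      (∫ t in (0:ℝ)..T, ∫ q in {q : E2 × E2 | |q.1 0 - q.2 0| < 1/M},
          M * ‖(starRingEnd ℂ) (v t q.2) * pd 0 (fun z => u t z) q.1
              + u t q.1 * pd 0 (fun z => (starRingEnd ℂ) (v t z)) q.2‖^2)
        ≤ C * (L2norm (fun z => v 0 z)^2 * L2norm (fun z => u 0 z)
              * H1norm (fun z => u 0 z)
            + L2norm (fun z => u 0 z)^2 * L2norm (fun z => v 0 z)
              * H1norm (fun z => v 0 z)) := by
  refine ⟨Real.pi * (1 + T), by positivity, fun M hM u v hu hv => ?_⟩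
  have h := integral_transDeriv_le hu hv hT.le (zero_lt_one.trans_le hM)
  have h1 : L2norm (rightWave v 0) = L2norm (fun z => v 0 z) := L2norm_conj _
  have h2 : H1norm (rightWave v 0) = H1norm (fun z => v 0 z) := H1norm_conj (v 0).isSchwartz
  rw [virialBound, h1, h2] at h
  have h3 : ∀ t (q : E2 × E2), (starRingEnd ℂ) (v t q.2) * pd 0 (fun z => u t z) q.1
      + u t q.1 * pd 0 (fun z => (starRingEnd ℂ) (v t z)) q.2 =
      transDeriv (leftWave u t) (rightWave v t) q := fun t q => by
    rw [mul_comm]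
    rfl
  simp only [h3]
  exact h
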